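/- arXiv:1707.03033 — 2 statements merged into one kernel-verified Lean document; each statement's English description precedes it below -/
import Mathlib

section
/- Let (A, ·, ∘) be a Hopf brace over a field k and let H be a commutative and cocommutative Hopf algebra over k. Suppose (A, ▶) is a left H-module algebra (with respect to the multiplication ·) and (A∘, H, ▶, ◀) is a matched pair of Hopf algebras (where A∘ denotes the Hopf algebra (A, ∘)) such that x ◀ (a·a') = (x₍₁₎ ◀ a)·S(x₍₂₎)·(x₍₃₎ ◀ a') for all a, a' ∈ A and x ∈ H, where S is the antipode of H. Then the tensor product coalgebra A ⊗ H, equipped with the two multiplications (a ⊗ x)(b ⊗ y) = a·b ⊗ xy and (a ⊗ x) ∘ (b ⊗ y) = (a ∘ (x₍₁₎ ▶ b₍₁₎)) ⊗ (x₍₂₎ ◀ b₍₂₎)y, is a Hopf brace. -/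
/-! Common definitions for formalizing "Constructing Hopf braces" (Agore). -/

open TensorProduct LinearMap

namespace HopfBraceNL

universe u

variable (k : Type u) [Field k]

section HopfStr

variable (V : Type u) [AddCommGroup V] [Module k V] [Coalgebra k V]

/-- The coalgebra `V` is cocommutative. -/
def IsCocomm : Prop :=
  (TensorProduct.comm k V V).toLinearMap ∘ₗ (Coalgebra.comul (R := k) (A := V)) =
    Coalgebra.comul (R := k) (A := V)

/-- A Hopf algebra structure on the underlying coalgebra of `V`: a multiplication, unit and
antipode making `V` a Hopf algebra whose comultiplication and counit are the given ones. -/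
structure HopfStr where
  mul : V ⊗[k] V →ₗ[k] V
  one : V
  mul_assoc : ∀ a b c : V, mul (mul (a ⊗ₜ[k] b) ⊗ₜ[k] c) = mul (a ⊗ₜ[k] mul (b ⊗ₜ[k] c))
  one_mul : ∀ a : V, mul (one ⊗ₜ[k] a) = a
  mul_one : ∀ a : V, mul (a ⊗ₜ[k] one) = a
  comul_mul : ∀ a b : V,
    Coalgebra.comul (R := k) (mul (a ⊗ₜ[k] b)) =
      TensorProduct.map mul mul
        (TensorProduct.tensorTensorTensorComm k V V V V
          (Coalgebra.comul (R := k) a ⊗ₜ[k] Coalgebra.comul (R := k) b))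
  counit_mul : ∀ a b : V,
    Coalgebra.counit (R := k) (mul (a ⊗ₜ[k] b)) =
      Coalgebra.counit (R := k) a * Coalgebra.counit (R := k) b
  comul_one : Coalgebra.comul (R := k) one = one ⊗ₜ[k] one
  counit_one : Coalgebra.counit (R := k) one = 1
  antipode : V →ₗ[k] V
  antipode_left :
    mul ∘ₗ rTensor V antipode ∘ₗ Coalgebra.comul =
      toSpanSingleton k V one ∘ₗ Coalgebra.counit
  antipode_right :
    mul ∘ₗ lTensor V antipode ∘ₗ Coalgebra.comul =
      toSpanSingleton k V one ∘ₗ Coalgebra.counit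

variable {k V}

/-- The Hopf structure is commutative. -/
def HopfStr.IsComm (hs : HopfStr k V) : Prop :=
  ∀ x y : V, hs.mul (x ⊗ₜ[k] y) = hs.mul (y ⊗ₜ[k] x)

/-- The linear map `x ⊗ y ⊗ z ↦ (x₍₁₎ ∘ y)·S(x₍₂₎)·(x₍₃₎ ∘ z)` (Sweedler notation), the right
hand side of the Hopf brace compatibility condition, written point-free.  Here `m` and `S` are
the multiplication and antipode of the first Hopf structure and `m'` the multiplication of the
second one. -/
noncomputable def braceRHS (m : V ⊗[k] V →ₗ[k] V) (S : V →ₗ[k] V)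
    (m' : V ⊗[k] V →ₗ[k] V) : V ⊗[k] (V ⊗[k] V) →ₗ[k] V :=
  m ∘ₗ lTensor V m
    ∘ₗ TensorProduct.map m' (TensorProduct.map S m')
    ∘ₗ lTensor (V ⊗[k] V) (TensorProduct.assoc k V V V).toLinearMap
    ∘ₗ (TensorProduct.tensorTensorTensorComm k V (V ⊗[k] V) V V).toLinearMap
    ∘ₗ rTensor (V ⊗[k] V)
        ((lTensor V (Coalgebra.comul (R := k))) ∘ₗ (Coalgebra.comul (R := k) (A := V)))

variable (k V) in
/-- A Hopf brace on the coalgebra `V`: two Hopf algebra structures subject to the compatibility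
`x ∘ (y·z) = (x₍₁₎ ∘ y)·S(x₍₂₎)·(x₍₃₎ ∘ z)`. -/
structure HopfBrace where
  dot : HopfStr k V
  circ : HopfStr k V
  brace : circ.mul ∘ₗ lTensor V dot.mul = braceRHS dot.mul dot.antipode circ.mul

/-- A solution of the braid equation on `V ⊗ V`. -/
def SolvesBraid {W : Type u} [AddCommGroup W] [Module k W]
    (c : W ⊗[k] W →ₗ[k] W ⊗[k] W) : Prop :=
  letI c₁ : (W ⊗[k] W) ⊗[k] W →ₗ[k] (W ⊗[k] W) ⊗[k] W := rTensor W c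
  letI c₂ : (W ⊗[k] W) ⊗[k] W →ₗ[k] (W ⊗[k] W) ⊗[k] W :=
    (TensorProduct.assoc k W W W).symm.toLinearMap ∘ₗ lTensor W c ∘ₗ
      (TensorProduct.assoc k W W W).toLinearMap
  c₁ ∘ₗ c₂ ∘ₗ c₁ = c₂ ∘ₗ c₁ ∘ₗ c₂

end HopfStr

section Actions

variable {k}
variable {A H : Type u}
  [AddCommGroup A] [Module k A] [Coalgebra k A]
  [AddCommGroup H] [Module k H] [Coalgebra k H]

/-- `(x, a) ↦ (x₍₁₎ ⊗ a₍₁₎) ⊗ (x₍₂₎ ⊗ a₍₂₎)`, as an element. -/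
noncomputable def split (x : H) (a : A) : (H ⊗[k] A) ⊗[k] (H ⊗[k] A) :=
  TensorProduct.tensorTensorTensorComm k H H A A
    (Coalgebra.comul (R := k) x ⊗ₜ[k] Coalgebra.comul (R := k) a)

/-- `A` is a left module over the Hopf structure `hH` via `act`. -/
structure IsLeftModule (hH : HopfStr k H) (act : H ⊗[k] A →ₗ[k] A) : Prop where
  one_act : ∀ a : A, act (hH.one ⊗ₜ[k] a) = a
  mul_act : ∀ (x y : H) (a : A),
    act (hH.mul (x ⊗ₜ[k] y) ⊗ₜ[k] a) = act (x ⊗ₜ[k] act (y ⊗ₜ[k] a))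

/-- `A` is a left module over `hH`-op via `act`, i.e. `(xy) ▶ a = y ▶ (x ▶ a)`. -/
structure IsLeftOpModule (hH : HopfStr k H) (act : H ⊗[k] A →ₗ[k] A) : Prop where
  one_act : ∀ a : A, act (hH.one ⊗ₜ[k] a) = a
  mul_act : ∀ (x y : H) (a : A),
    act (hH.mul (x ⊗ₜ[k] y) ⊗ₜ[k] a) = act (y ⊗ₜ[k] act (x ⊗ₜ[k] a))

/-- The measuring conditions: `x ▶ (ab) = (x₍₁₎ ▶ a)(x₍₂₎ ▶ b)` and `x ▶ 1 = ε(x)1`. -/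
structure IsModuleAlgebraLaw (hA : HopfStr k A) (act : H ⊗[k] A →ₗ[k] A) : Prop where
  act_mul : ∀ (x : H) (a b : A),
    act (x ⊗ₜ[k] hA.mul (a ⊗ₜ[k] b)) =
      hA.mul (TensorProduct.map act act
        (TensorProduct.tensorTensorTensorComm k H H A A
          (Coalgebra.comul (R := k) x ⊗ₜ[k] (a ⊗ₜ[k] b))))
  act_one : ∀ x : H, act (x ⊗ₜ[k] hA.one) = Coalgebra.counit (R := k) x • hA.one

/-- `act` is a coalgebra map: `Δ(x ▶ a) = (x₍₁₎ ▶ a₍₁₎) ⊗ (x₍₂₎ ▶ a₍₂₎)`,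
`ε(x ▶ a) = ε(x)ε(a)`. -/
structure IsCoalgebraLaw (act : H ⊗[k] A →ₗ[k] A) : Prop where
  comul_act : ∀ (x : H) (a : A),
    Coalgebra.comul (R := k) (act (x ⊗ₜ[k] a)) = TensorProduct.map act act (split x a)
  counit_act : ∀ (x : H) (a : A),
    Coalgebra.counit (R := k) (act (x ⊗ₜ[k] a)) =
      Coalgebra.counit (R := k) x * Coalgebra.counit (R := k) a

/-- `(A, act)` is a left `hH`-module algebra. -/
structure IsLeftModuleAlgebra (hH : HopfStr k H) (hA : HopfStr k A)
    (act : H ⊗[k] A →ₗ[k] A) : Prop where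
  toIsLeftModule : IsLeftModule hH act
  toLaw : IsModuleAlgebraLaw hA act

/-- `(A, act)` is a left `hH`-module coalgebra. -/
structure IsLeftModuleCoalgebra (hH : HopfStr k H) (act : H ⊗[k] A →ₗ[k] A) : Prop where
  toIsLeftModule : IsLeftModule hH act
  toCoalgLaw : IsCoalgebraLaw act

/-- `(A, act)` is a left `hH`-module bialgebra. -/
structure IsLeftModuleBialgebra (hH : HopfStr k H) (hA : HopfStr k A)
    (act : H ⊗[k] A →ₗ[k] A) : Prop where
  toIsLeftModule : IsLeftModule hH act
  toLaw : IsModuleAlgebraLaw hA act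
  toCoalgLaw : IsCoalgebraLaw act

/-- `(A, act)` is a left `hH`-op-module bialgebra. -/
structure IsLeftOpModuleBialgebra (hH : HopfStr k H) (hA : HopfStr k A)
    (act : H ⊗[k] A →ₗ[k] A) : Prop where
  toIsLeftOpModule : IsLeftOpModule hH act
  toLaw : IsModuleAlgebraLaw hA act
  toCoalgLaw : IsCoalgebraLaw act

/-- `H` is a right module over the Hopf structure `hA` via `ract : H ⊗ A → H`. -/
structure IsRightModule (hA : HopfStr k A) (ract : H ⊗[k] A →ₗ[k] H) : Prop where
  act_one : ∀ x : H, ract (x ⊗ₜ[k] hA.one) = x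
  act_mul : ∀ (x : H) (a b : A),
    ract (x ⊗ₜ[k] hA.mul (a ⊗ₜ[k] b)) = ract (ract (x ⊗ₜ[k] a) ⊗ₜ[k] b)

/-- `ract` is a coalgebra map `H ⊗ A → H`. -/
structure IsRightCoalgebraLaw (ract : H ⊗[k] A →ₗ[k] H) : Prop where
  comul_act : ∀ (x : H) (a : A),
    Coalgebra.comul (R := k) (ract (x ⊗ₜ[k] a)) = TensorProduct.map ract ract (split x a)
  counit_act : ∀ (x : H) (a : A),
    Coalgebra.counit (R := k) (ract (x ⊗ₜ[k] a)) =
      Coalgebra.counit (R := k) x * Coalgebra.counit (R := k) a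

/-- `(H, ract)` is a right `hA`-module bialgebra:  in addition to the module and coalgebra
conditions, `(xy) ◁ a = (x ◁ a₍₁₎)(y ◁ a₍₂₎)` and `1 ◁ a = ε(a)1`. -/
structure IsRightModuleBialgebra (hA : HopfStr k A) (hH : HopfStr k H)
    (ract : H ⊗[k] A →ₗ[k] H) : Prop where
  toIsRightModule : IsRightModule hA ract
  mul_ract : ∀ (x y : H) (a : A),
    ract (hH.mul (x ⊗ₜ[k] y) ⊗ₜ[k] a) =
      hH.mul (TensorProduct.map ract ract
        (TensorProduct.tensorTensorTensorComm k H H A A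
          ((x ⊗ₜ[k] y) ⊗ₜ[k] Coalgebra.comul (R := k) a)))
  one_ract : ∀ a : A, ract (hH.one ⊗ₜ[k] a) = Coalgebra.counit (R := k) a • hH.one
  toCoalgLaw : IsRightCoalgebraLaw ract

/-- `(A, H, tri, quad)` is a matched pair of Hopf algebras. -/
structure IsMatchedPair (hA : HopfStr k A) (hH : HopfStr k H)
    (tri : H ⊗[k] A →ₗ[k] A) (quad : H ⊗[k] A →ₗ[k] H) : Prop where
  tri_module : IsLeftModule hH tri
  tri_coalg : IsCoalgebraLaw tri
  quad_module : IsRightModule hA quad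
  quad_coalg : IsRightCoalgebraLaw quad
  mp1 : ∀ x : H, tri (x ⊗ₜ[k] hA.one) = Coalgebra.counit (R := k) x • hA.one
  mp1' : ∀ a : A, quad (hH.one ⊗ₜ[k] a) = Coalgebra.counit (R := k) a • hH.one
  mp2 : ∀ (x : H) (a b : A),
    tri (x ⊗ₜ[k] hA.mul (a ⊗ₜ[k] b)) =
      hA.mul (lTensor A tri (TensorProduct.assoc k A H A
        ((TensorProduct.map tri quad (split x a)) ⊗ₜ[k] b)))
  mp3 : ∀ (x y : H) (a : A),
    quad (hH.mul (x ⊗ₜ[k] y) ⊗ₜ[k] a) =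
      hH.mul (rTensor H quad ((TensorProduct.assoc k H A H).symm
        (x ⊗ₜ[k] TensorProduct.map tri quad (split y a))))
  mp4 : ∀ (x : H) (a : A),
    TensorProduct.map quad tri (split x a) =
      TensorProduct.comm k A H (TensorProduct.map tri quad (split x a))

variable (k) in
/-- `(a ⊗ (u₁ ⊗ u₂)) ⊗ y ↦ mA (a ⊗ u₁) ⊗ mH (u₂ ⊗ y)`: the standard way to assemble
a multiplication on `A ⊗ H` from a middle term `u ∈ A ⊗ H`. -/
noncomputable def sandwich (mA : A ⊗[k] A →ₗ[k] A) (mH : H ⊗[k] H →ₗ[k] H) :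
    (A ⊗[k] (A ⊗[k] H)) ⊗[k] H →ₗ[k] A ⊗[k] H :=
  TensorProduct.map mA mH
    ∘ₗ (TensorProduct.assoc k (A ⊗[k] A) H H).toLinearMap
    ∘ₗ rTensor H (TensorProduct.assoc k A A H).symm.toLinearMap

variable (k) in
/-- `(m ⊗ n) ⊗ p ↦ (m ⊗ p) ⊗ n`. -/
noncomputable def rightComm (M N P : Type u) [AddCommGroup M] [Module k M]
    [AddCommGroup N] [Module k N] [AddCommGroup P] [Module k P] :
    (M ⊗[k] N) ⊗[k] P →ₗ[k] (M ⊗[k] P) ⊗[k] N :=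
  (TensorProduct.assoc k M P N).symm.toLinearMap
    ∘ₗ lTensor M (TensorProduct.comm k N P).toLinearMap
    ∘ₗ (TensorProduct.assoc k M N P).toLinearMap

/-- `(x, b) ↦ (x₍₁₎ ▷ b₍₁₎) ⊗ (x₍₂₎ ◁ b₍₂₎)`. -/
noncomputable def matchedEl (tri : H ⊗[k] A →ₗ[k] A) (quad : H ⊗[k] A →ₗ[k] H)
    (x : H) (b : A) : A ⊗[k] H :=
  TensorProduct.map tri quad (split x b)

/-- `(x, b) ↦ (x₍₁₎ ▷ b) ⊗ x₍₂₎`. -/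
noncomputable def smashEl (tri : H ⊗[k] A →ₗ[k] A) (x : H) (b : A) : A ⊗[k] H :=
  rTensor H tri (rightComm k H H A (Coalgebra.comul (R := k) x ⊗ₜ[k] b))

/-- `(x, b) ↦ b₍₁₎ ⊗ (x ◁ b₍₂₎)`. -/
noncomputable def rsmashEl (ract : H ⊗[k] A →ₗ[k] H) (x : H) (b : A) : A ⊗[k] H :=
  lTensor A ract (TensorProduct.leftComm k H A A (x ⊗ₜ[k] Coalgebra.comul (R := k) b))

end Actions

section Convolution

variable {k}
variable {C D V W U X Y : Type u}
  [AddCommGroup C] [Module k C] [Coalgebra k C]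
  [AddCommGroup D] [Module k D] [Coalgebra k D]
  [AddCommGroup V] [Module k V] [AddCommGroup W] [Module k W]
  [AddCommGroup U] [Module k U] [AddCommGroup X] [Module k X]
  [AddCommGroup Y] [Module k Y]

/-- The map `c ↦ f c₍₁₎ ⊗ g c₍₂₎`. -/
noncomputable def pair (f : C →ₗ[k] V) (g : C →ₗ[k] W) : C →ₗ[k] V ⊗[k] W :=
  TensorProduct.map f g ∘ₗ Coalgebra.comul

/-- The convolution `c ↦ m (f c₍₁₎ ⊗ g c₍₂₎)` of `f` and `g` along a bilinear operation `m`. -/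
noncomputable def conv (m : V ⊗[k] W →ₗ[k] U) (f : C →ₗ[k] V) (g : C →ₗ[k] W) : C →ₗ[k] U :=
  m ∘ₗ pair f g

/-- The linear maps `f` and `g` commute: `f c₍₁₎ ⊗ g c₍₂₎ = f c₍₂₎ ⊗ g c₍₁₎`. -/
def Commutes (f : C →ₗ[k] V) (g : C →ₗ[k] W) : Prop :=
  (TensorProduct.comm k V W).toLinearMap ∘ₗ pair f g = pair g f

/-- The linear map `f` is a homomorphism of coalgebras. -/
structure IsCoalgMap (f : C →ₗ[k] D) : Prop where
  comul_comp : Coalgebra.comul ∘ₗ f = pair f f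
  counit_comp : Coalgebra.counit ∘ₗ f = Coalgebra.counit (R := k)

/-- The map `c ↦ ε c • v`. -/
noncomputable def const (C : Type u) [AddCommGroup C] [Module k C] [Coalgebra k C] (v : V) :
    C →ₗ[k] V :=
  toSpanSingleton k V v ∘ₗ Coalgebra.counit

lemma map_comp_pair (φ : V →ₗ[k] X) (ψ : W →ₗ[k] Y) (f : C →ₗ[k] V) (g : C →ₗ[k] W) :
    TensorProduct.map φ ψ ∘ₗ pair f g = pair (φ ∘ₗ f) (ψ ∘ₗ g) := by
  rw [pair, pair, TensorProduct.map_comp, comp_assoc]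

lemma rTensor_comp_pair (φ : V →ₗ[k] X) (f : C →ₗ[k] V) (g : C →ₗ[k] W) :
    rTensor W φ ∘ₗ pair f g = pair (φ ∘ₗ f) g :=
  map_comp_pair φ LinearMap.id f g

lemma lTensor_comp_pair (ψ : W →ₗ[k] Y) (f : C →ₗ[k] V) (g : C →ₗ[k] W) :
    lTensor V ψ ∘ₗ pair f g = pair f (ψ ∘ₗ g) :=
  map_comp_pair LinearMap.id ψ f g

lemma assoc_comp_pair (f : C →ₗ[k] V) (g : C →ₗ[k] W) (h : C →ₗ[k] U) :
    (TensorProduct.assoc k V W U).toLinearMap ∘ₗ pair (pair f g) h = pair f (pair g h) := by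
  have h1 : pair (pair f g) h = TensorProduct.map (TensorProduct.map f g) h ∘ₗ
      rTensor C Coalgebra.comul ∘ₗ Coalgebra.comul := by
    rw [← comp_assoc, rTensor, ← TensorProduct.map_comp]; rfl
  have h2 : pair f (pair g h) = TensorProduct.map f (TensorProduct.map g h) ∘ₗ
      lTensor C Coalgebra.comul ∘ₗ Coalgebra.comul := by
    rw [← comp_assoc, lTensor, ← TensorProduct.map_comp]; rfl
  rw [h1, h2, ← Coalgebra.coassoc, ← comp_assoc, ← comp_assoc,
    ← TensorProduct.map_map_comp_assoc_eq, comp_assoc, comp_assoc]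

lemma assoc_symm_comp_pair (f : C →ₗ[k] V) (g : C →ₗ[k] W) (h : C →ₗ[k] U) :
    (TensorProduct.assoc k V W U).symm.toLinearMap ∘ₗ pair f (pair g h) =
      pair (pair f g) h := by
  rw [← assoc_comp_pair, ← comp_assoc]
  simp

lemma Commutes.symm {f : C →ₗ[k] V} {g : C →ₗ[k] W} (h : Commutes f g) : Commutes g f := by
  unfold Commutes at *
  rw [← h, ← comp_assoc]
  ext; simp

lemma Commutes.comp {f : C →ₗ[k] V} {g : C →ₗ[k] W} (h : Commutes f g)
    (φ : V →ₗ[k] X) (ψ : W →ₗ[k] Y) : Commutes (φ ∘ₗ f) (ψ ∘ₗ g) := by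
  unfold Commutes at *
  rw [← map_comp_pair, ← map_comp_pair, ← h, ← comp_assoc, ← comp_assoc,
    TensorProduct.map_comp_comm_eq]

lemma Commutes.comp_right {f : C →ₗ[k] V} {g : C →ₗ[k] W} (h : Commutes f g)
    (ψ : W →ₗ[k] Y) : Commutes f (ψ ∘ₗ g) :=
  h.comp LinearMap.id ψ

lemma Commutes.comp_left {f : C →ₗ[k] V} {g : C →ₗ[k] W} (h : Commutes f g)
    (φ : V →ₗ[k] X) : Commutes (φ ∘ₗ f) g :=
  h.comp φ LinearMap.id

lemma Commutes.pair_right {f : C →ₗ[k] V} {g : C →ₗ[k] W} {h : C →ₗ[k] U}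
    (hg : Commutes f g) (hh : Commutes f h) : Commutes f (pair g h) := by
  have key : (TensorProduct.comm k V (W ⊗[k] U)).toLinearMap =
      (TensorProduct.assoc k W U V).symm.toLinearMap ∘ₗ
        lTensor W (TensorProduct.comm k V U).toLinearMap ∘ₗ
        (TensorProduct.assoc k W V U).toLinearMap ∘ₗ
        rTensor U (TensorProduct.comm k V W).toLinearMap ∘ₗ
        (TensorProduct.assoc k V W U).symm.toLinearMap := by
    apply TensorProduct.ext_threefold'
    intros; simp
  unfold Commutes at *
  rw [key]
  simp only [comp_assoc]
  rw [assoc_symm_comp_pair, rTensor_comp_pair, hg, assoc_comp_pair, lTensor_comp_pair, hh,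
    assoc_symm_comp_pair]

lemma Commutes.conv_right {f : C →ₗ[k] V} {g : C →ₗ[k] W} {h : C →ₗ[k] U}
    (hg : Commutes f g) (hh : Commutes f h) (m : W ⊗[k] U →ₗ[k] X) :
    Commutes f (conv m g h) :=
  (hg.pair_right hh).comp_right m

lemma Commutes.conv_left {f : C →ₗ[k] V} {g : C →ₗ[k] W} {h : C →ₗ[k] U}
    (hg : Commutes g f) (hh : Commutes h f) (m : W ⊗[k] U →ₗ[k] X) :
    Commutes (conv m g h) f :=
  (hg.symm.conv_right hh.symm m).symm

lemma rightComm_comp_pair {f : C →ₗ[k] V} {g : C →ₗ[k] W} {h : C →ₗ[k] U}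
    (hgh : Commutes g h) :
    rightComm k V W U ∘ₗ pair (pair f g) h = pair (pair f h) g := by
  unfold rightComm
  simp only [comp_assoc]
  rw [assoc_comp_pair, lTensor_comp_pair, hgh, assoc_symm_comp_pair]

lemma tensorTensorTensorComm_comp_pair {f : C →ₗ[k] V} {g : C →ₗ[k] W} {h : C →ₗ[k] U}
    {i : C →ₗ[k] X} (hgh : Commutes g h) :
    (TensorProduct.tensorTensorTensorComm k V W U X).toLinearMap ∘ₗ
      pair (pair f g) (pair h i) = pair (pair f h) (pair g i) := by
  have key : (TensorProduct.tensorTensorTensorComm k V W U X).toLinearMap =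
      (TensorProduct.assoc k (V ⊗[k] U) W X).toLinearMap ∘ₗ
        rTensor X (rightComm k V W U) ∘ₗ
        (TensorProduct.assoc k (V ⊗[k] W) U X).symm.toLinearMap := by
    ext; simp [rightComm]
  rw [key]
  simp only [comp_assoc]
  rw [assoc_symm_comp_pair, rTensor_comp_pair, rightComm_comp_pair hgh, assoc_comp_pair]

lemma pair_const_left (v : V) (f : C →ₗ[k] W) :
    pair (const C v) f = TensorProduct.mk k V W v ∘ₗ f := by
  have h1 : pair (const C v) f =
      TensorProduct.map (toSpanSingleton k V v) f ∘ₗ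
        rTensor C Coalgebra.counit ∘ₗ Coalgebra.comul := by
    rw [← comp_assoc, rTensor, ← TensorProduct.map_comp]; rfl
  rw [h1]
  ext c
  simp

lemma pair_const_right (f : C →ₗ[k] V) (w : W) :
    pair f (const C w) = (TensorProduct.mk k V W).flip w ∘ₗ f := by
  have h1 : pair f (const C w) =
      TensorProduct.map f (toSpanSingleton k W w) ∘ₗ
        lTensor C Coalgebra.counit ∘ₗ Coalgebra.comul := by
    rw [← comp_assoc, lTensor, ← TensorProduct.map_comp]; rfl
  rw [h1]
  ext c
  simp

lemma commutes_const_left (v : V) (f : C →ₗ[k] W) : Commutes (const C v) f := by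
  unfold Commutes
  rw [pair_const_left, pair_const_right]
  ext; simp

lemma commutes_const_right (f : C →ₗ[k] W) (v : V) : Commutes f (const C v) :=
  (commutes_const_left v f).symm

lemma comp_const (φ : V →ₗ[k] W) (v : V) : φ ∘ₗ const C v = const C (φ v) := by
  ext; simp [const]

lemma pair_const_const (v : V) (w : W) :
    pair (const C v) (const C w) = const C (v ⊗ₜ[k] w) := by
  rw [pair_const_left, comp_const]; rfl

lemma conv_const_left (m : V ⊗[k] W →ₗ[k] U) (v : V) (f : C →ₗ[k] W) :
    conv m (const C v) f = m ∘ₗ TensorProduct.mk k V W v ∘ₗ f := by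
  rw [conv, pair_const_left]

lemma conv_const_right (m : V ⊗[k] W →ₗ[k] U) (f : C →ₗ[k] V) (w : W) :
    conv m f (const C w) = m ∘ₗ (TensorProduct.mk k V W).flip w ∘ₗ f := by
  rw [conv, pair_const_right]

lemma conv_assoc_of_comp_eq {m : V ⊗[k] V →ₗ[k] V}
    (hm : m ∘ₗ rTensor V m = m ∘ₗ lTensor V m ∘ₗ (TensorProduct.assoc k V V V).toLinearMap)
    (f g h : C →ₗ[k] V) : conv m (conv m f g) h = conv m f (conv m g h) := by
  rw [conv, conv, ← rTensor_comp_pair, ← comp_assoc, hm, comp_assoc, comp_assoc,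
    assoc_comp_pair, lTensor_comp_pair]
  rfl

end Convolution

section CoalgMaps

variable {k}
variable {C D E F V W : Type u}
  [AddCommGroup C] [Module k C] [Coalgebra k C]
  [AddCommGroup D] [Module k D] [Coalgebra k D]
  [AddCommGroup E] [Module k E] [Coalgebra k E]
  [AddCommGroup F] [Module k F] [Coalgebra k F]
  [AddCommGroup V] [Module k V] [AddCommGroup W] [Module k W]

lemma pair_comp {φ : C →ₗ[k] D} (hφ : IsCoalgMap φ) (f : D →ₗ[k] V) (g : D →ₗ[k] W) :
    pair f g ∘ₗ φ = pair (f ∘ₗ φ) (g ∘ₗ φ) := by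
  rw [pair, comp_assoc, hφ.comul_comp, map_comp_pair]

lemma Commutes.precomp {f : D →ₗ[k] V} {g : D →ₗ[k] W} (h : Commutes f g)
    {φ : C →ₗ[k] D} (hφ : IsCoalgMap φ) : Commutes (f ∘ₗ φ) (g ∘ₗ φ) := by
  unfold Commutes at *
  rw [← pair_comp hφ, ← pair_comp hφ, ← comp_assoc, h]

lemma isCoalgMap_id : IsCoalgMap (LinearMap.id : C →ₗ[k] C) where
  comul_comp := by simp [pair]
  counit_comp := by simp

lemma IsCoalgMap.comp {ψ : D →ₗ[k] E} (hψ : IsCoalgMap ψ) {φ : C →ₗ[k] D}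
    (hφ : IsCoalgMap φ) : IsCoalgMap (ψ ∘ₗ φ) where
  comul_comp := by rw [← comp_assoc, hψ.comul_comp, pair_comp hφ]
  counit_comp := by rw [← comp_assoc, hψ.counit_comp, hφ.counit_comp]

lemma comul_tensor : (Coalgebra.comul : D ⊗[k] E →ₗ[k] (D ⊗[k] E) ⊗[k] (D ⊗[k] E)) =
    (TensorProduct.tensorTensorTensorComm k D D E E).toLinearMap ∘ₗ
      TensorProduct.map Coalgebra.comul Coalgebra.comul := rfl

lemma counit_comp_pair {f : C →ₗ[k] D} {g : C →ₗ[k] E}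
    (hg : Coalgebra.counit ∘ₗ g = Coalgebra.counit (R := k)) :
    Coalgebra.counit ∘ₗ pair f g = Coalgebra.counit (R := k) ∘ₗ f := by
  have h : (Coalgebra.counit : D ⊗[k] E →ₗ[k] k) =
      (TensorProduct.lid k k).toLinearMap ∘ₗ
        TensorProduct.map Coalgebra.counit Coalgebra.counit := by
    ext; simp [mul_comm]
  have h2 : Coalgebra.counit (R := k) (A := C) = const C (1 : k) := by ext; simp [const]
  rw [h, comp_assoc, map_comp_pair, hg, h2, pair_const_right]
  ext; simp

lemma IsCoalgMap.pair {f : C →ₗ[k] D} {g : C →ₗ[k] E}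
    (hf : IsCoalgMap f) (hg : IsCoalgMap g) (h : Commutes f g) : IsCoalgMap (pair f g) where
  comul_comp := by
    rw [comul_tensor, comp_assoc, map_comp_pair, hf.comul_comp, hg.comul_comp,
      tensorTensorTensorComm_comp_pair h]
  counit_comp := (counit_comp_pair hg.counit_comp).trans hf.counit_comp

lemma IsCoalgMap.conv {m : D ⊗[k] E →ₗ[k] F} (hm : IsCoalgMap m) {f : C →ₗ[k] D}
    {g : C →ₗ[k] E} (hf : IsCoalgMap f) (hg : IsCoalgMap g) (h : Commutes f g) :
    IsCoalgMap (conv m f g) :=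
  hm.comp (hf.pair hg h)

lemma isCoalgMap_const {d : D} (h : Coalgebra.comul (R := k) d = d ⊗ₜ[k] d)
    (h' : Coalgebra.counit (R := k) d = 1) : IsCoalgMap (const (k := k) C d) where
  comul_comp := by rw [comp_const, pair_const_const, h]
  counit_comp := by rw [comp_const, h']; ext; simp [const]

/-- The projection `d ⊗ e ↦ ε e • d`. -/
noncomputable def fst (D E : Type u) [AddCommGroup D] [Module k D]
    [AddCommGroup E] [Module k E] [Coalgebra k E] : D ⊗[k] E →ₗ[k] D :=
  (TensorProduct.rid k D).toLinearMap ∘ₗ lTensor D Coalgebra.counit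

/-- The projection `d ⊗ e ↦ ε d • e`. -/
noncomputable def snd (D E : Type u) [AddCommGroup D] [Module k D] [Coalgebra k D]
    [AddCommGroup E] [Module k E] : D ⊗[k] E →ₗ[k] E :=
  (TensorProduct.lid k E).toLinearMap ∘ₗ rTensor E Coalgebra.counit

lemma counit_counit_comul (e : E) :
    (TensorProduct.lid k k) (TensorProduct.map Coalgebra.counit Coalgebra.counit
      (Coalgebra.comul (R := k) e)) = Coalgebra.counit (R := k) e := by
  have h : TensorProduct.map (Coalgebra.counit (R := k)) Coalgebra.counit
      (Coalgebra.comul (R := k) e) =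
      lTensor k Coalgebra.counit (rTensor E Coalgebra.counit (Coalgebra.comul (R := k) e)) := by
    rw [← LinearMap.comp_apply (lTensor k _), lTensor_comp_rTensor]
  rw [h, Coalgebra.rTensor_counit_comul]
  simp

lemma isCoalgMap_fst : IsCoalgMap (fst (k := k) D E) where
  comul_comp := by
    have key : TensorProduct.map (fst (k := k) D E) (fst D E) ∘ₗ
        (TensorProduct.tensorTensorTensorComm k D D E E).toLinearMap =
        (TensorProduct.rid k (D ⊗[k] D)).toLinearMap ∘ₗ
          lTensor (D ⊗[k] D) ((TensorProduct.lid k k).toLinearMap ∘ₗ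
            TensorProduct.map Coalgebra.counit Coalgebra.counit) := by
      ext; simp [fst, smul_tmul', tmul_smul, smul_smul, mul_comm]
    rw [pair, comul_tensor, ← comp_assoc, key]
    ext d e
    simp [fst, counit_counit_comul]
  counit_comp := by ext; simp [fst]

lemma isCoalgMap_snd : IsCoalgMap (snd (k := k) D E) where
  comul_comp := by
    have key : TensorProduct.map (snd (k := k) D E) (snd D E) ∘ₗ
        (TensorProduct.tensorTensorTensorComm k D D E E).toLinearMap =
        (TensorProduct.lid k (E ⊗[k] E)).toLinearMap ∘ₗ
          rTensor (E ⊗[k] E) ((TensorProduct.lid k k).toLinearMap ∘ₗ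
            TensorProduct.map Coalgebra.counit Coalgebra.counit) := by
      ext; simp [snd, smul_tmul', tmul_smul, smul_smul, mul_comm]
    rw [pair, comul_tensor, ← comp_assoc, key]
    ext d e
    simp [snd, counit_counit_comul]
  counit_comp := by ext; simp [snd, mul_comm]

lemma pair_fst_snd : pair (fst (k := k) D E) (snd D E) = LinearMap.id := by
  have key : TensorProduct.map (fst (k := k) D E) (snd D E) ∘ₗ
      (TensorProduct.tensorTensorTensorComm k D D E E).toLinearMap =
      TensorProduct.map
        ((TensorProduct.rid k D).toLinearMap ∘ₗ lTensor D Coalgebra.counit)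
        ((TensorProduct.lid k E).toLinearMap ∘ₗ rTensor E Coalgebra.counit) := by
    ext; simp [fst, snd, smul_tmul', tmul_smul, smul_smul, mul_comm]
  rw [pair, comul_tensor, ← comp_assoc, key]
  ext; simp

lemma commutes_fst_snd : Commutes (fst (k := k) D E) (snd D E) := by
  have key : TensorProduct.map (snd (k := k) D E) (fst D E) ∘ₗ
      (TensorProduct.tensorTensorTensorComm k D D E E).toLinearMap =
      (TensorProduct.comm k D E).toLinearMap ∘ₗ TensorProduct.map
        ((TensorProduct.lid k D).toLinearMap ∘ₗ rTensor D Coalgebra.counit)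
        ((TensorProduct.rid k E).toLinearMap ∘ₗ lTensor E Coalgebra.counit) := by
    ext; simp [fst, snd, smul_tmul', tmul_smul, smul_smul, mul_comm]
  rw [Commutes, pair_fst_snd, pair, comul_tensor, ← comp_assoc, key]
  ext; simp

/-- Linear maps on a threefold tensor product of coalgebras agree as soon as they agree on all
triples of pairwise commuting coalgebra maps. -/
lemma ext_pair_pair {f g : D ⊗[k] (E ⊗[k] F) →ₗ[k] V}
    (h : ∀ (u : D ⊗[k] (E ⊗[k] F) →ₗ[k] D) (v : D ⊗[k] (E ⊗[k] F) →ₗ[k] E)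
      (w : D ⊗[k] (E ⊗[k] F) →ₗ[k] F), IsCoalgMap u → IsCoalgMap v → IsCoalgMap w →
      Commutes u v → Commutes u w → Commutes v w →
      f ∘ₗ pair u (pair v w) = g ∘ₗ pair u (pair v w)) : f = g := by
  have key := h (fst D (E ⊗[k] F)) (fst E F ∘ₗ snd D (E ⊗[k] F)) (snd E F ∘ₗ snd D (E ⊗[k] F))
    isCoalgMap_fst (isCoalgMap_fst.comp isCoalgMap_snd) (isCoalgMap_snd.comp isCoalgMap_snd)
    (commutes_fst_snd.comp_right _) (commutes_fst_snd.comp_right _)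
    (commutes_fst_snd.precomp isCoalgMap_snd)
  rwa [← pair_comp isCoalgMap_snd, pair_fst_snd, id_comp, pair_fst_snd, comp_id, comp_id] at key

/-- A coalgebra map to `D ⊗ E` is the pairing of its two components. -/
lemma pair_fst_comp_snd_comp (u : C →ₗ[k] D ⊗[k] E) (hu : IsCoalgMap u) :
    pair (fst D E ∘ₗ u) (snd D E ∘ₗ u) = u := by
  rw [← pair_comp hu, pair_fst_snd, id_comp]

end CoalgMaps

section HopfConvolution

variable {k}
variable {C V W : Type u}
  [AddCommGroup C] [Module k C] [Coalgebra k C]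
  [AddCommGroup V] [Module k V] [Coalgebra k V]
  [AddCommGroup W] [Module k W] [Coalgebra k W]

lemma braceRHS_comp_pair (m m' : V ⊗[k] V →ₗ[k] V) (S : V →ₗ[k] V)
    {u v w : C →ₗ[k] V} (hu : IsCoalgMap u) (huv : Commutes u v) :
    braceRHS m S m' ∘ₗ pair u (pair v w) =
      conv m (conv m' u v) (conv m (S ∘ₗ u) (conv m' u w)) := by
  unfold braceRHS
  simp only [comp_assoc]
  rw [rTensor_comp_pair, comp_assoc, hu.comul_comp, lTensor_comp_pair, hu.comul_comp,
    tensorTensorTensorComm_comp_pair (huv.symm.pair_right huv.symm).symm, lTensor_comp_pair,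
    assoc_comp_pair, map_comp_pair, map_comp_pair, lTensor_comp_pair]
  rfl

lemma comp_rTensor_eq_of_conv_assoc {m : V ⊗[k] V →ₗ[k] V}
    (hm : ∀ {u v w : V ⊗[k] (V ⊗[k] V) →ₗ[k] V}, IsCoalgMap u → IsCoalgMap v →
      IsCoalgMap w → Commutes u v → Commutes u w → Commutes v w →
      conv m (conv m u v) w = conv m u (conv m v w)) :
    m ∘ₗ rTensor V m = m ∘ₗ lTensor V m ∘ₗ (TensorProduct.assoc k V V V).toLinearMap := by
  have key : m ∘ₗ rTensor V m ∘ₗ (TensorProduct.assoc k V V V).symm.toLinearMap =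
      m ∘ₗ lTensor V m := by
    refine ext_pair_pair fun u v w hu hv hw huv huw hvw => ?_
    simp only [comp_assoc]
    rw [assoc_symm_comp_pair, rTensor_comp_pair, lTensor_comp_pair]
    exact hm hu hv hw huv huw hvw
  rw [← comp_assoc _ _ m, ← key]
  ext; simp

namespace HopfStr

variable (hs : HopfStr k V)

lemma isCoalgMap_mul : IsCoalgMap hs.mul where
  comul_comp := TensorProduct.ext' hs.comul_mul
  counit_comp := by
    refine TensorProduct.ext' fun a b => ?_
    rw [comp_apply, hs.counit_mul, mul_comm]
    rfl

lemma isCoalgMap_one : IsCoalgMap (const (k := k) C hs.one) :=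
  isCoalgMap_const hs.comul_one hs.counit_one

lemma conv_assoc (f g h : C →ₗ[k] V) :
    conv hs.mul (conv hs.mul f g) h = conv hs.mul f (conv hs.mul g h) :=
  conv_assoc_of_comp_eq (TensorProduct.ext_threefold hs.mul_assoc) f g h

lemma one_conv (f : C →ₗ[k] V) : conv hs.mul (const C hs.one) f = f := by
  rw [conv_const_left]
  ext c
  exact hs.one_mul _

lemma conv_one (f : C →ₗ[k] V) : conv hs.mul f (const C hs.one) = f := by
  rw [conv_const_right]
  ext c
  exact hs.mul_one _

lemma antipode_conv {f : C →ₗ[k] V} (hf : IsCoalgMap f) :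
    conv hs.mul (hs.antipode ∘ₗ f) f = const C hs.one := by
  rw [conv, ← rTensor_comp_pair, ← hf.comul_comp]
  simpa only [const, comp_assoc, hf.counit_comp] using congrArg (· ∘ₗ f) hs.antipode_left

lemma conv_antipode {f : C →ₗ[k] V} (hf : IsCoalgMap f) :
    conv hs.mul f (hs.antipode ∘ₗ f) = const C hs.one := by
  rw [conv, ← lTensor_comp_pair, ← hf.comul_comp]
  simpa only [const, comp_assoc, hf.counit_comp] using congrArg (· ∘ₗ f) hs.antipode_right

variable {hs} in
lemma IsComm.conv_comm (hc : hs.IsComm) {f g : C →ₗ[k] V} (h : Commutes f g) :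
    conv hs.mul f g = conv hs.mul g f := by
  have key : hs.mul ∘ₗ (TensorProduct.comm k V V).toLinearMap = hs.mul :=
    TensorProduct.ext' fun x y => hc y x
  rw [conv, conv, ← h, ← comp_assoc, key]

/-- A Hopf algebra structure on the coalgebra `V` from identities between convolutions. -/
noncomputable def ofConv (mul : V ⊗[k] V →ₗ[k] V) (one : V) (antipode : V →ₗ[k] V)
    (mul_assoc : mul ∘ₗ rTensor V mul =
      mul ∘ₗ lTensor V mul ∘ₗ (TensorProduct.assoc k V V V).toLinearMap)
    (one_conv : conv mul (const V one) LinearMap.id = LinearMap.id)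
    (conv_one : conv mul LinearMap.id (const V one) = LinearMap.id)
    (isCoalgMap_mul : ∀ {u v : V ⊗[k] V →ₗ[k] V}, IsCoalgMap u → IsCoalgMap v →
      Commutes u v → IsCoalgMap (conv mul u v))
    (comul_one : Coalgebra.comul (R := k) one = one ⊗ₜ[k] one)
    (counit_one : Coalgebra.counit (R := k) one = 1)
    (antipode_conv : conv mul antipode LinearMap.id = const V one)
    (conv_antipode : conv mul LinearMap.id antipode = const V one) : HopfStr k V where
  mul := mul
  one := one
  mul_assoc a b c := LinearMap.congr_fun mul_assoc ((a ⊗ₜ[k] b) ⊗ₜ[k] c)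
  one_mul a := by
    rw [conv_const_left] at one_conv
    exact LinearMap.congr_fun one_conv a
  mul_one a := by
    rw [conv_const_right] at conv_one
    exact LinearMap.congr_fun conv_one a
  comul_mul a b := by
    have key := (isCoalgMap_mul isCoalgMap_fst isCoalgMap_snd commutes_fst_snd).comul_comp
    simp only [conv, pair_fst_snd, comp_id] at key
    exact LinearMap.congr_fun key (a ⊗ₜ[k] b)
  counit_mul a b := by
    have key := (isCoalgMap_mul isCoalgMap_fst isCoalgMap_snd commutes_fst_snd).counit_comp
    simp only [conv, pair_fst_snd, comp_id] at key
    exact (LinearMap.congr_fun key (a ⊗ₜ[k] b)).trans (mul_comm _ _)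
  comul_one := comul_one
  counit_one := counit_one
  antipode := antipode
  antipode_left := antipode_conv
  antipode_right := conv_antipode

end HopfStr

lemma HopfBrace.circ_conv (B : HopfBrace k V) {u v w : C →ₗ[k] V} (hu : IsCoalgMap u)
    (huv : Commutes u v) :
    conv B.circ.mul u (conv B.dot.mul v w) = conv B.dot.mul (conv B.circ.mul u v)
      (conv B.dot.mul (B.dot.antipode ∘ₗ u) (conv B.circ.mul u w)) := by
  rw [← braceRHS_comp_pair _ _ _ hu huv, ← B.brace, comp_assoc, lTensor_comp_pair]
  rfl

lemma IsCocomm.commutes_self (h : IsCocomm k V) {f : C →ₗ[k] V} (hf : IsCoalgMap f) :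
    Commutes f f := by
  unfold Commutes
  rw [← hf.comul_comp, ← comp_assoc, h]

end HopfConvolution

section CoalgebraActions

variable {k}
variable {A H : Type u} [AddCommGroup A] [Module k A] [Coalgebra k A]
  [AddCommGroup H] [Module k H] [Coalgebra k H]
  {tri : H ⊗[k] A →ₗ[k] A} {quad : H ⊗[k] A →ₗ[k] H}

lemma IsCoalgebraLaw.isCoalgMap (h : IsCoalgebraLaw tri) : IsCoalgMap tri where
  comul_comp := TensorProduct.ext' h.comul_act
  counit_comp := TensorProduct.ext' fun x a => (h.counit_act x a).trans (mul_comm _ _)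

lemma IsRightCoalgebraLaw.isCoalgMap (h : IsRightCoalgebraLaw quad) : IsCoalgMap quad where
  comul_comp := TensorProduct.ext' h.comul_act
  counit_comp := TensorProduct.ext' fun x a => (h.counit_act x a).trans (mul_comm _ _)

end CoalgebraActions

section LeftActions

variable {k}
variable {C A H : Type u} [AddCommGroup C] [Module k C] [Coalgebra k C]
  [AddCommGroup A] [Module k A]
  [AddCommGroup H] [Module k H] [Coalgebra k H]
  {hH : HopfStr k H} {tri : H ⊗[k] A →ₗ[k] A}

lemma IsLeftModule.one_conv (h : IsLeftModule hH tri) (a : C →ₗ[k] A) :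
    conv tri (const C hH.one) a = a := by
  rw [conv_const_left]
  ext c
  exact h.one_act _

lemma IsLeftModule.mul_conv (h : IsLeftModule hH tri) (x y : C →ₗ[k] H) (a : C →ₗ[k] A) :
    conv tri (conv hH.mul x y) a = conv tri x (conv tri y a) := by
  have key : tri ∘ₗ rTensor A hH.mul =
      tri ∘ₗ lTensor H tri ∘ₗ (TensorProduct.assoc k H H A).toLinearMap := by
    ext x y a
    exact h.mul_act x y a
  rw [conv, conv, ← rTensor_comp_pair, ← comp_assoc, key, comp_assoc, comp_assoc,
    assoc_comp_pair, lTensor_comp_pair]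
  rfl

end LeftActions

section RightActions

variable {k}
variable {C A H : Type u} [AddCommGroup C] [Module k C] [Coalgebra k C]
  [AddCommGroup A] [Module k A] [Coalgebra k A]
  [AddCommGroup H] [Module k H]
  {hA : HopfStr k A} {quad : H ⊗[k] A →ₗ[k] H}

lemma IsRightModule.conv_one (h : IsRightModule hA quad) (x : C →ₗ[k] H) :
    conv quad x (const C hA.one) = x := by
  rw [conv_const_right]
  ext c
  exact h.act_one _

lemma IsRightModule.conv_mul (h : IsRightModule hA quad) (x : C →ₗ[k] H) (a b : C →ₗ[k] A) :
    conv quad x (conv hA.mul a b) = conv quad (conv quad x a) b := by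
  have key : quad ∘ₗ lTensor H hA.mul =
      quad ∘ₗ rTensor A quad ∘ₗ (TensorProduct.assoc k H A A).symm.toLinearMap := by
    refine TensorProduct.ext (LinearMap.ext fun x => TensorProduct.ext' fun a b => ?_)
    exact h.act_mul x a b
  rw [conv, conv, ← lTensor_comp_pair, ← comp_assoc, key, comp_assoc, comp_assoc,
    assoc_symm_comp_pair, rTensor_comp_pair]
  rfl

end RightActions

section ModuleAlgebras

variable {k}
variable {C A H : Type u} [AddCommGroup C] [Module k C] [Coalgebra k C]
  [AddCommGroup A] [Module k A] [Coalgebra k A]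
  [AddCommGroup H] [Module k H] [Coalgebra k H]
  {hA : HopfStr k A} {tri : H ⊗[k] A →ₗ[k] A}

lemma IsModuleAlgebraLaw.conv_mul (h : IsModuleAlgebraLaw hA tri) {x : C →ₗ[k] H}
    {a b : C →ₗ[k] A} (hx : IsCoalgMap x) (hxa : Commutes x a) :
    conv tri x (conv hA.mul a b) = conv hA.mul (conv tri x a) (conv tri x b) := by
  have key : tri ∘ₗ lTensor H hA.mul =
      hA.mul ∘ₗ TensorProduct.map tri tri ∘ₗ
        (TensorProduct.tensorTensorTensorComm k H H A A).toLinearMap ∘ₗ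
        rTensor (A ⊗[k] A) Coalgebra.comul := by
    refine TensorProduct.ext (LinearMap.ext fun x => TensorProduct.ext' fun a b => ?_)
    exact h.act_mul x a b
  rw [conv, conv, ← lTensor_comp_pair, ← comp_assoc, key]
  simp only [comp_assoc]
  rw [rTensor_comp_pair, hx.comul_comp, tensorTensorTensorComm_comp_pair hxa, map_comp_pair]
  rfl

end ModuleAlgebras

section TensorProducts

variable {k}
variable {C A H : Type u}
  [AddCommGroup C] [Module k C] [Coalgebra k C]
  [AddCommGroup A] [Module k A] [Coalgebra k A]
  [AddCommGroup H] [Module k H] [Coalgebra k H]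

lemma comul_one_tmul_one (hA : HopfStr k A) (hH : HopfStr k H) :
    Coalgebra.comul (R := k) (hA.one ⊗ₜ[k] hH.one) =
      (hA.one ⊗ₜ[k] hH.one) ⊗ₜ[k] (hA.one ⊗ₜ[k] hH.one) := by
  simp [hA.comul_one, hH.comul_one]

lemma counit_one_tmul_one (hA : HopfStr k A) (hH : HopfStr k H) :
    Coalgebra.counit (R := k) (hA.one ⊗ₜ[k] hH.one) = 1 := by
  simp [hA.counit_one, hH.counit_one]

/-- The multiplication `(a ⊗ x)(b ⊗ y) = ab ⊗ xy`. -/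
noncomputable def tensorMul (hA : HopfStr k A) (hH : HopfStr k H) :
    (A ⊗[k] H) ⊗[k] (A ⊗[k] H) →ₗ[k] A ⊗[k] H :=
  TensorProduct.map hA.mul hH.mul ∘ₗ
    (TensorProduct.tensorTensorTensorComm k A H A H).toLinearMap

lemma conv_tensorMul (hA : HopfStr k A) (hH : HopfStr k H) {a b : C →ₗ[k] A}
    {x y : C →ₗ[k] H} (hxb : Commutes x b) :
    conv (tensorMul hA hH) (pair a x) (pair b y) =
      pair (conv hA.mul a b) (conv hH.mul x y) := by
  rw [conv, tensorMul, comp_assoc, tensorTensorTensorComm_comp_pair hxb, map_comp_pair]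
  rfl

/-- The tensor product of two Hopf algebras. -/
noncomputable def HopfStr.tensor (hA : HopfStr k A) (hH : HopfStr k H) :
    HopfStr k (A ⊗[k] H) :=
  HopfStr.ofConv (tensorMul hA hH) (hA.one ⊗ₜ[k] hH.one)
    (TensorProduct.map hA.antipode hH.antipode)
    (by ext; simp [tensorMul, hA.mul_assoc, hH.mul_assoc])
    (by
      rw [← pair_fst_snd, ← pair_const_const, conv_tensorMul _ _ (commutes_const_left _ _),
        hA.one_conv, hH.one_conv])
    (by
      rw [← pair_fst_snd, ← pair_const_const, conv_tensorMul _ _ (commutes_const_right _ _),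
        hA.conv_one, hH.conv_one])
    (by
      intro u v hu hv huv
      rw [← pair_fst_comp_snd_comp u hu, ← pair_fst_comp_snd_comp v hv,
        conv_tensorMul _ _ (huv.comp _ _)]
      have ha := isCoalgMap_fst.comp hu
      have hx := isCoalgMap_snd.comp hu
      have hb := isCoalgMap_fst.comp hv
      have hy := isCoalgMap_snd.comp hv
      refine (hA.isCoalgMap_mul.conv ha hb (huv.comp _ _)).pair
        (hH.isCoalgMap_mul.conv hx hy (huv.comp _ _)) (Commutes.conv_left ?_ ?_ _)
      · exact (commutes_fst_snd.precomp hu).conv_right (huv.comp _ _) _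
      · exact (huv.symm.comp _ _).conv_right (commutes_fst_snd.precomp hv) _)
    (comul_one_tmul_one hA hH) (counit_one_tmul_one hA hH)
    (by
      rw [← comp_id (TensorProduct.map _ _), ← pair_fst_snd, map_comp_pair,
        conv_tensorMul _ _ (commutes_fst_snd.symm.comp_left _), hA.antipode_conv isCoalgMap_fst,
        hH.antipode_conv isCoalgMap_snd, pair_const_const])
    (by
      rw [← comp_id (TensorProduct.map _ _), ← pair_fst_snd, map_comp_pair,
        conv_tensorMul _ _ (commutes_fst_snd.symm.comp_right _), hA.conv_antipode isCoalgMap_fst,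
        hH.conv_antipode isCoalgMap_snd, pair_const_const])

end TensorProducts

section MatchedPairs

variable {k}
variable {C A H : Type u}
  [AddCommGroup C] [Module k C] [Coalgebra k C]
  [AddCommGroup A] [Module k A] [Coalgebra k A]
  [AddCommGroup H] [Module k H] [Coalgebra k H]
  {hA : HopfStr k A} {hH : HopfStr k H} {tri : H ⊗[k] A →ₗ[k] A} {quad : H ⊗[k] A →ₗ[k] H}

lemma conv_exchange {x : C →ₗ[k] H} {b : C →ₗ[k] A} (hx : IsCoalgMap x) (hb : IsCoalgMap b)
    (hxb : Commutes x b) :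
    conv (pair tri quad) x b = pair (conv tri x b) (conv quad x b) :=
  pair_comp (hx.pair hb hxb) _ _

/-- The multiplication `(a ⊗ x) ∘ (b ⊗ y) = (a ∘ (x₍₁₎ ▷ b₍₁₎)) ⊗ (x₍₂₎ ◁ b₍₂₎)y` of the
bicrossed product. -/
noncomputable def bicrossedMul (hA : HopfStr k A) (hH : HopfStr k H)
    (tri : H ⊗[k] A →ₗ[k] A) (quad : H ⊗[k] A →ₗ[k] H) :
    (A ⊗[k] H) ⊗[k] (A ⊗[k] H) →ₗ[k] A ⊗[k] H :=
  sandwich k hA.mul hH.mul ∘ₗ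
    rTensor H (lTensor A (pair tri quad) ∘ₗ (TensorProduct.assoc k A H A).toLinearMap) ∘ₗ
    (TensorProduct.assoc k (A ⊗[k] H) A H).symm.toLinearMap

lemma conv_bicrossedMul_of_conv_pair {a b t : C →ₗ[k] A} {x y q : C →ₗ[k] H}
    (h : conv (pair tri quad) x b = pair t q) :
    conv (bicrossedMul hA hH tri quad) (pair a x) (pair b y) =
      pair (conv hA.mul a t) (conv hH.mul q y) := by
  unfold bicrossedMul sandwich
  rw [conv]
  simp only [comp_assoc]
  rw [assoc_symm_comp_pair, rTensor_comp_pair, comp_assoc, assoc_comp_pair, lTensor_comp_pair,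
    show pair tri quad ∘ₗ pair x b = pair t q from h, rTensor_comp_pair, assoc_symm_comp_pair,
    assoc_comp_pair, map_comp_pair]
  rfl

lemma conv_bicrossedMul {a b : C →ₗ[k] A} {x y : C →ₗ[k] H} (hx : IsCoalgMap x)
    (hb : IsCoalgMap b) (hxb : Commutes x b) :
    conv (bicrossedMul hA hH tri quad) (pair a x) (pair b y) =
      pair (conv hA.mul a (conv tri x b)) (conv hH.mul (conv quad x b) y) :=
  conv_bicrossedMul_of_conv_pair (conv_exchange hx hb hxb)

namespace IsMatchedPair

lemma conv_tri_one (h : IsMatchedPair hA hH tri quad) {x : C →ₗ[k] H}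
    (hx : Coalgebra.counit ∘ₗ x = Coalgebra.counit (R := k)) :
    conv tri x (const C hA.one) = const C hA.one := by
  rw [conv_const_right, const, ← hx]
  ext c
  exact h.mp1 _

lemma one_conv_quad (h : IsMatchedPair hA hH tri quad) {a : C →ₗ[k] A}
    (ha : Coalgebra.counit ∘ₗ a = Coalgebra.counit (R := k)) :
    conv quad (const C hH.one) a = const C hH.one := by
  rw [conv_const_left, const, ← ha]
  ext c
  exact h.mp1' _

lemma conv_tri_mul (h : IsMatchedPair hA hH tri quad) {x : C →ₗ[k] H} {a b : C →ₗ[k] A}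
    (hx : IsCoalgMap x) (ha : IsCoalgMap a) (hxa : Commutes x a) :
    conv tri x (conv hA.mul a b) =
      conv hA.mul (conv tri x a) (conv tri (conv quad x a) b) := by
  have key : tri ∘ₗ lTensor H hA.mul =
      hA.mul ∘ₗ lTensor A tri ∘ₗ (TensorProduct.assoc k A H A).toLinearMap ∘ₗ
        rTensor A (pair tri quad) ∘ₗ (TensorProduct.assoc k H A A).symm.toLinearMap := by
    refine TensorProduct.ext (LinearMap.ext fun x => TensorProduct.ext' fun a b => ?_)
    exact h.mp2 x a b
  rw [conv, conv, ← lTensor_comp_pair, ← comp_assoc, key]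
  simp only [comp_assoc]
  rw [assoc_symm_comp_pair, rTensor_comp_pair,
    show pair tri quad ∘ₗ pair x a = _ from conv_exchange hx ha hxa, assoc_comp_pair,
    lTensor_comp_pair]
  rfl

lemma mul_conv_quad (h : IsMatchedPair hA hH tri quad) {x y : C →ₗ[k] H} {a : C →ₗ[k] A}
    (hy : IsCoalgMap y) (ha : IsCoalgMap a) (hya : Commutes y a) :
    conv quad (conv hH.mul x y) a =
      conv hH.mul (conv quad x (conv tri y a)) (conv quad y a) := by
  have key : quad ∘ₗ rTensor A hH.mul =
      hH.mul ∘ₗ rTensor H quad ∘ₗ (TensorProduct.assoc k H A H).symm.toLinearMap ∘ₗ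
        lTensor H (pair tri quad) ∘ₗ (TensorProduct.assoc k H H A).toLinearMap := by
    ext x y a
    exact h.mp3 x y a
  rw [conv, conv, ← rTensor_comp_pair, ← comp_assoc, key]
  simp only [comp_assoc]
  rw [assoc_comp_pair, lTensor_comp_pair,
    show pair tri quad ∘ₗ pair y a = _ from conv_exchange hy ha hya, assoc_symm_comp_pair,
    rTensor_comp_pair]
  rfl

lemma commutes_tri_quad (h : IsMatchedPair hA hH tri quad) : Commutes tri quad :=
  TensorProduct.ext' fun x a => (h.mp4 x a).symm

lemma commutes_conv (h : IsMatchedPair hA hH tri quad) {x : C →ₗ[k] H} {a : C →ₗ[k] A}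
    (hx : IsCoalgMap x) (ha : IsCoalgMap a) (hxa : Commutes x a) :
    Commutes (conv tri x a) (conv quad x a) :=
  h.commutes_tri_quad.precomp (hx.pair ha hxa)

lemma one_conv_exchange (h : IsMatchedPair hA hH tri quad) (b : C →ₗ[k] A) :
    conv (pair tri quad) (const C hH.one) b = pair b (const C hH.one) := by
  have key : conv (pair tri quad) (const A hH.one) LinearMap.id =
      pair LinearMap.id (const A hH.one) := by
    rw [conv_exchange hH.isCoalgMap_one isCoalgMap_id (commutes_const_left _ _),
      h.tri_module.one_conv, h.one_conv_quad isCoalgMap_id.counit_comp]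
  rw [conv_const_left, pair_const_right] at *
  rw [← comp_assoc]
  exact congrArg (· ∘ₗ b) key

lemma exchange_conv_one (h : IsMatchedPair hA hH tri quad) (x : C →ₗ[k] H) :
    conv (pair tri quad) x (const C hA.one) = pair (const C hA.one) x := by
  have key : conv (pair tri quad) LinearMap.id (const H hA.one) =
      pair (const H hA.one) LinearMap.id := by
    rw [conv_exchange isCoalgMap_id hA.isCoalgMap_one (commutes_const_right _ _),
      h.quad_module.conv_one, h.conv_tri_one isCoalgMap_id.counit_comp]
  rw [conv_const_right, pair_const_left] at *
  rw [← comp_assoc]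
  exact congrArg (· ∘ₗ x) key

lemma conv_bicrossedMul_one_left (h : IsMatchedPair hA hH tri quad) (a b : C →ₗ[k] A)
    (y : C →ₗ[k] H) :
    conv (bicrossedMul hA hH tri quad) (pair a (const C hH.one)) (pair b y) =
      pair (conv hA.mul a b) y := by
  rw [conv_bicrossedMul_of_conv_pair (h.one_conv_exchange b), hH.one_conv]

lemma conv_bicrossedMul_one_right (h : IsMatchedPair hA hH tri quad) (a : C →ₗ[k] A)
    (x y : C →ₗ[k] H) :
    conv (bicrossedMul hA hH tri quad) (pair a x) (pair (const C hA.one) y) =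
      pair a (conv hH.mul x y) := by
  rw [conv_bicrossedMul_of_conv_pair (h.exchange_conv_one x), hA.conv_one]

lemma isCoalgMap_conv_bicrossedMul (h : IsMatchedPair hA hH tri quad)
    {u v : C →ₗ[k] A ⊗[k] H} (hu : IsCoalgMap u) (hv : IsCoalgMap v) (huv : Commutes u v) :
    IsCoalgMap (conv (bicrossedMul hA hH tri quad) u v) := by
  rw [← pair_fst_comp_snd_comp u hu, ← pair_fst_comp_snd_comp v hv]
  have ha := isCoalgMap_fst.comp hu
  have hx := isCoalgMap_snd.comp hu
  have hb := isCoalgMap_fst.comp hv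
  have hy := isCoalgMap_snd.comp hv
  have hax := commutes_fst_snd.precomp hu
  have hby := commutes_fst_snd.precomp hv
  have hab := huv.comp (fst A H) (fst A H)
  have hay := huv.comp (fst A H) (snd A H)
  have hxb := huv.comp (snd A H) (fst A H)
  have hxy := huv.comp (snd A H) (snd A H)
  have ht := h.tri_coalg.isCoalgMap.conv hx hb hxb
  have hq := h.quad_coalg.isCoalgMap.conv hx hb hxb
  rw [conv_bicrossedMul hx hb hxb]
  refine (hA.isCoalgMap_mul.conv ha ht (hax.conv_right hab _)).pair
    (hH.isCoalgMap_mul.conv hq hy (hxy.conv_left hby _)) (Commutes.conv_left ?_ ?_ _)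
  · exact (hax.conv_right hab _).conv_right hay _
  · exact (h.commutes_conv hx hb hxb).conv_right (hxy.conv_left hby _) _

lemma bicrossedMul_assoc (h : IsMatchedPair hA hH tri quad) :
    bicrossedMul hA hH tri quad ∘ₗ rTensor (A ⊗[k] H) (bicrossedMul hA hH tri quad) =
      bicrossedMul hA hH tri quad ∘ₗ lTensor (A ⊗[k] H) (bicrossedMul hA hH tri quad) ∘ₗ
        (TensorProduct.assoc k (A ⊗[k] H) (A ⊗[k] H) (A ⊗[k] H)).toLinearMap := by
  refine comp_rTensor_eq_of_conv_assoc fun {u v w} hu hv hw huv huw hvw => ?_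
  rw [← pair_fst_comp_snd_comp u hu, ← pair_fst_comp_snd_comp v hv, ← pair_fst_comp_snd_comp w hw]
  have hx := isCoalgMap_snd.comp hu
  have hb := isCoalgMap_fst.comp hv
  have hy := isCoalgMap_snd.comp hv
  have hc := isCoalgMap_fst.comp hw
  have hby := commutes_fst_snd.precomp hv
  have hxb := huv.comp (snd A H) (fst A H)
  have hxy := huv.comp (snd A H) (snd A H)
  have hxc := huw.comp (snd A H) (fst A H)
  have hbc := hvw.comp (fst A H) (fst A H)
  have hyc := hvw.comp (snd A H) (fst A H)
  have hq := h.quad_coalg.isCoalgMap.conv hx hb hxb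
  have ht := h.tri_coalg.isCoalgMap.conv hy hc hyc
  rw [conv_bicrossedMul hx hb hxb, conv_bicrossedMul hy hc hyc,
    conv_bicrossedMul (hH.isCoalgMap_mul.conv hq hy (hxy.conv_left hby _)) hc
      ((hxc.conv_left hbc _).conv_left hyc _),
    conv_bicrossedMul hx (hA.isCoalgMap_mul.conv hb ht (hby.conv_right hbc _))
      (hxb.conv_right (hxy.conv_right hxc _) _),
    h.conv_tri_mul hx hb hxb, h.mul_conv_quad hy hc hyc, h.tri_module.mul_conv,
    h.quad_module.conv_mul, hA.conv_assoc, hH.conv_assoc]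

/-- The bicrossed product of a matched pair of Hopf algebras. -/
noncomputable def bicrossed (h : IsMatchedPair hA hH tri quad) : HopfStr k (A ⊗[k] H) :=
  HopfStr.ofConv (bicrossedMul hA hH tri quad) (hA.one ⊗ₜ[k] hH.one)
    (conv (bicrossedMul hA hH tri quad)
      (pair (const _ hA.one) (hH.antipode ∘ₗ snd A H))
      (pair (hA.antipode ∘ₗ fst A H) (const _ hH.one)))
    h.bicrossedMul_assoc
    (by
      rw [← pair_fst_snd, ← pair_const_const, h.conv_bicrossedMul_one_left, hA.one_conv])
    (by
      rw [← pair_fst_snd, ← pair_const_const, h.conv_bicrossedMul_one_right, hH.conv_one])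
    h.isCoalgMap_conv_bicrossedMul
    (comul_one_tmul_one hA hH) (counit_one_tmul_one hA hH)
    (by
      rw [conv_assoc_of_comp_eq h.bicrossedMul_assoc, ← pair_fst_snd,
        h.conv_bicrossedMul_one_left, hA.antipode_conv isCoalgMap_fst,
        h.conv_bicrossedMul_one_right, hH.antipode_conv isCoalgMap_snd, pair_const_const])
    (by
      rw [← conv_assoc_of_comp_eq h.bicrossedMul_assoc, ← pair_fst_snd,
        h.conv_bicrossedMul_one_right, hH.conv_antipode isCoalgMap_snd,
        h.conv_bicrossedMul_one_left, hA.conv_antipode isCoalgMap_fst, pair_const_const])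

end IsMatchedPair

end MatchedPairs

section RightActionCompatibility

variable {k}
variable {C A H : Type u}
  [AddCommGroup C] [Module k C] [Coalgebra k C]
  [AddCommGroup A] [Module k A] [Coalgebra k A]
  [AddCommGroup H] [Module k H] [Coalgebra k H]

/-- The convolution form of the identity `x ◁ (a·a') = (x₍₁₎ ◁ a)·S(x₍₂₎)·(x₍₃₎ ◁ a')`. -/
lemma conv_ract_mul {hA : HopfStr k A} {hH : HopfStr k H} {ract : H ⊗[k] A →ₗ[k] H}
    (h : ∀ (x : H) (a a' : A),
      ract (x ⊗ₜ[k] hA.mul (a ⊗ₜ[k] a')) =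
        hH.mul (rTensor H hH.mul
          (TensorProduct.map
            (TensorProduct.map (ract ∘ₗ (TensorProduct.mk k H A).flip a) hH.antipode)
            (ract ∘ₗ (TensorProduct.mk k H A).flip a')
            (rTensor H (Coalgebra.comul (R := k)) (Coalgebra.comul (R := k) x)))))
    {x : C →ₗ[k] H} {a b : C →ₗ[k] A} (hx : IsCoalgMap x) (hxa : Commutes x a) :
    conv ract x (conv hA.mul a b) =
      conv hH.mul (conv hH.mul (conv ract x a) (hH.antipode ∘ₗ x)) (conv ract x b) := by
  have key : ract ∘ₗ lTensor H hA.mul =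
      hH.mul ∘ₗ rTensor H hH.mul ∘ₗ
        TensorProduct.map (TensorProduct.map ract hH.antipode) ract ∘ₗ
        rTensor (H ⊗[k] A) (rightComm k H H A) ∘ₗ
        (TensorProduct.tensorTensorTensorComm k (H ⊗[k] H) H A A).toLinearMap ∘ₗ
        rTensor (A ⊗[k] A) (rTensor H Coalgebra.comul ∘ₗ Coalgebra.comul) := by
    refine TensorProduct.ext (LinearMap.ext fun x => TensorProduct.ext' fun a b => ?_)
    refine (h x a b).trans (congrArg (fun t => hH.mul (rTensor H hH.mul t)) ?_)
    have perm : TensorProduct.map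
          (TensorProduct.map (ract ∘ₗ (TensorProduct.mk k H A).flip a) hH.antipode)
          (ract ∘ₗ (TensorProduct.mk k H A).flip b) =
        TensorProduct.map (TensorProduct.map ract hH.antipode) ract ∘ₗ
          rTensor (H ⊗[k] A) (rightComm k H H A) ∘ₗ
          (TensorProduct.tensorTensorTensorComm k (H ⊗[k] H) H A A).toLinearMap ∘ₗ
          (TensorProduct.mk k ((H ⊗[k] H) ⊗[k] H) (A ⊗[k] A)).flip (a ⊗ₜ[k] b) := by
      ext; simp [rightComm]
    rw [perm]
    rfl
  rw [conv, conv, ← lTensor_comp_pair, ← comp_assoc, key]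
  simp only [comp_assoc]
  rw [rTensor_comp_pair, comp_assoc, hx.comul_comp, rTensor_comp_pair, hx.comul_comp,
    tensorTensorTensorComm_comp_pair hxa, rTensor_comp_pair, rightComm_comp_pair hxa,
    map_comp_pair, map_comp_pair, rTensor_comp_pair]
  rfl

end RightActionCompatibility

/-- Theorem `main0`. Let `(A, ·, ∘)` be a Hopf brace and `H` a commutative,
cocommutative Hopf algebra. If `(A, ▶)` is a left `H`-module algebra (w.r.t. `·`) and
`(A∘, H, ▶, ◀)` is a matched pair of Hopf algebras such that
`x ◀ (a·a') = (x₍₁₎ ◀ a)·S(x₍₂₎)·(x₍₃₎ ◀ a')`, then the tensor product coalgebra `A ⊗ H` with the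
multiplications `(a ⊗ x)(b ⊗ y) = a·b ⊗ xy` and
`(a ⊗ x) ∘ (b ⊗ y) = (a ∘ (x₍₁₎ ▶ b₍₁₎)) ⊗ (x₍₂₎ ◀ b₍₂₎)y` is a Hopf brace. -/
theorem statement0 {k : Type u} [Field k]
    {A H : Type u} [AddCommGroup A] [Module k A] [Coalgebra k A]
    [AddCommGroup H] [Module k H] [Coalgebra k H]
    (BA : HopfBrace k A) (hH : HopfStr k H)
    (hHcomm : hH.IsComm) (hHcocomm : IsCocomm k H)
    (act : H ⊗[k] A →ₗ[k] A) (ract : H ⊗[k] A →ₗ[k] H)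
    (hma : IsLeftModuleAlgebra hH BA.dot act)
    (hmp : IsMatchedPair BA.circ hH act ract)
    (h146 : ∀ (x : H) (a a' : A),
      ract (x ⊗ₜ[k] BA.dot.mul (a ⊗ₜ[k] a')) =
        hH.mul (rTensor H hH.mul
          (TensorProduct.map
            (TensorProduct.map (ract ∘ₗ (TensorProduct.mk k H A).flip a) hH.antipode)
            (ract ∘ₗ (TensorProduct.mk k H A).flip a')
            (rTensor H (Coalgebra.comul (R := k)) (Coalgebra.comul (R := k) x))))) :
    ∃ B : HopfBrace k (A ⊗[k] H),
      (∀ (a b : A) (x y : H),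
        B.dot.mul ((a ⊗ₜ[k] x) ⊗ₜ[k] (b ⊗ₜ[k] y)) =
          BA.dot.mul (a ⊗ₜ[k] b) ⊗ₜ[k] hH.mul (x ⊗ₜ[k] y)) ∧
      (∀ (a b : A) (x y : H),
        B.circ.mul ((a ⊗ₜ[k] x) ⊗ₜ[k] (b ⊗ₜ[k] y)) =
          sandwich k BA.circ.mul hH.mul ((a ⊗ₜ[k] matchedEl act ract x b) ⊗ₜ[k] y)) := by
  let D := BA.dot.tensor hH
  let B := hmp.bicrossed
  refine ⟨⟨D, B, ext_pair_pair fun u v w hu hv hw huv huw hvw => ?_⟩,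
    fun a b x y => rfl, fun a b x y => rfl⟩
  rw [braceRHS_comp_pair _ _ _ hu huv, comp_assoc, lTensor_comp_pair]
  have ha := isCoalgMap_fst.comp hu
  have hx := isCoalgMap_snd.comp hu
  have hb := isCoalgMap_fst.comp hv
  have hc := isCoalgMap_fst.comp hw
  have hax := commutes_fst_snd.precomp hu
  have hby := commutes_fst_snd.precomp hv
  have hab := huv.comp (fst A H) (fst A H)
  have hxb := huv.comp (snd A H) (fst A H)
  have hay := huv.comp (fst A H) (snd A H)
  have hxy := huv.comp (snd A H) (snd A H)
  have hac := huw.comp (fst A H) (fst A H)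
  have hxc := huw.comp (snd A H) (fst A H)
  have hbc := hvw.comp (fst A H) (fst A H)
  have hyc := hvw.comp (snd A H) (fst A H)
  have hxx := hHcocomm.commutes_self hx
  rw [← pair_fst_comp_snd_comp u hu, ← pair_fst_comp_snd_comp v hv, ← pair_fst_comp_snd_comp w hw]
  set a := fst A H ∘ₗ u
  set x := snd A H ∘ₗ u
  set b := fst A H ∘ₗ v
  set y := snd A H ∘ₗ v
  set c := fst A H ∘ₗ w
  set z := snd A H ∘ₗ w
  have hS : D.antipode ∘ₗ pair a x = pair (BA.dot.antipode ∘ₗ a) (hH.antipode ∘ₗ x) :=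
    map_comp_pair _ _ _ _
  have hyq : Commutes y (conv ract x c) := hxy.symm.conv_right hyc _
  change conv B.mul (pair a x) (conv D.mul (pair b y) (pair c z)) = _
  rw [hS]
  change conv (bicrossedMul BA.circ hH act ract) (pair a x)
      (conv (tensorMul BA.dot hH) (pair b y) (pair c z)) =
    conv (tensorMul BA.dot hH) (conv (bicrossedMul BA.circ hH act ract) (pair a x) (pair b y))
      (conv (tensorMul BA.dot hH) (pair (BA.dot.antipode ∘ₗ a) (hH.antipode ∘ₗ x))
        (conv (bicrossedMul BA.circ hH act ract) (pair a x) (pair c z)))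
  rw [conv_bicrossedMul hx hb hxb, conv_bicrossedMul hx hc hxc, conv_tensorMul _ _ hyc,
    conv_bicrossedMul hx (BA.dot.isCoalgMap_mul.conv hb hc hbc) (hxb.conv_right hxc _),
    conv_tensorMul _ _ ((hax.symm.conv_right (hxx.conv_right hxc _) _).comp_left _),
    conv_tensorMul _ _ (Commutes.conv_right
      (((hax.symm.conv_left hab.symm _).conv_left hay.symm _).comp_right _)
      (Commutes.conv_left ?_ (hay.symm.conv_right (hxy.symm.conv_right hyc _) _) _) _),
    hma.toLaw.conv_mul hx hxb, BA.circ_conv ha (hax.conv_right hab _),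
    conv_ract_mul h146 hx hxb]
  · congr 1
    simp only [hH.conv_assoc]
    rw [← hH.conv_assoc y, hHcomm.conv_comm (hxy.symm.comp_right _), hH.conv_assoc,
      ← hH.conv_assoc y, hHcomm.conv_comm hyq, hH.conv_assoc]
  · exact (hax.symm.conv_right (hxx.conv_right hxc _) _).conv_left
      (hab.symm.conv_right (hxb.symm.conv_right hbc _) _) _

end HopfBraceNL
end

section
/- Let (A, ·, ∘) be a Hopf brace over a field k and let H be a commutative and cocommutative Hopf algebra over k. Suppose ▶: H ⊗ A → A is a left H-module structure on A making (A, ▶) a left H-module algebra (with respect to ·) and making (A∘, ▶) a left H-module bialgebra (where A∘ denotes the Hopf algebra (A, ∘)). Then the tensor product coalgebra A ⊗ H, equipped with the two multiplications (a ⊗ x)(b ⊗ y) = a·b ⊗ xy and (a ⊗ x) ∘ (b ⊗ y) = (a ∘ (x₍₁₎ ▶ b₍₁₎)) ⊗ x₍₂₎y, is a Hopf brace. -/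
/-! Common definitions for formalizing "Constructing Hopf braces" (Agore). -/

open TensorProduct LinearMap

namespace HopfBraceNL

universe u

variable (k : Type u) [Field k]

section DistributiveLaw

variable {k}
variable {A H : Type u}
  [AddCommGroup A] [Module k A] [Coalgebra k A]
  [AddCommGroup H] [Module k H] [Coalgebra k H]

/-- The multiplication of a Hopf structure as a coalgebra morphism. -/
noncomputable def HopfStr.mulHom (hA : HopfStr k A) : A ⊗[k] A →ₗc[k] A where
  __ := hA.mul
  counit_comp := by ext; simp [hA.counit_mul, mul_comm]
  map_comp_comul := by
    ext a b
    simp [hA.comul_mul, TensorProduct.AlgebraTensorModule.tensorTensorTensorComm_eq]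

@[simp]
theorem HopfStr.mulHom_apply (hA : HopfStr k A) (t : A ⊗[k] A) : hA.mulHom t = hA.mul t := rfl

theorem HopfStr.mul_rTensor_antipode_comul (hA : HopfStr k A) (a : A) :
    hA.mul (rTensor A hA.antipode (Coalgebra.comul a)) =
      Coalgebra.counit (R := k) a • hA.one :=
  LinearMap.congr_fun hA.antipode_left a

theorem HopfStr.mul_lTensor_antipode_comul (hA : HopfStr k A) (a : A) :
    hA.mul (lTensor A hA.antipode (Coalgebra.comul a)) =
      Coalgebra.counit (R := k) a • hA.one :=
  LinearMap.congr_fun hA.antipode_right a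

/-- The map `b ⊗ v ↦ a·b ⊗ v·y`. -/
noncomputable def bimul (hA : HopfStr k A) (hH : HopfStr k H) (a : A) (y : H) :
    A ⊗[k] H →ₗ[k] A ⊗[k] H :=
  TensorProduct.map (hA.mul ∘ₗ TensorProduct.mk k A A a)
    (hH.mul ∘ₗ (TensorProduct.mk k H H).flip y)

@[simp]
theorem bimul_tmul (hA : HopfStr k A) (hH : HopfStr k H) (a b : A) (x y : H) :
    bimul hA hH a y (b ⊗ₜ x) = hA.mul (a ⊗ₜ b) ⊗ₜ hH.mul (x ⊗ₜ y) := rfl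

theorem bimul_bimul (hA : HopfStr k A) (hH : HopfStr k H) (a b : A) (x y : H) (t : A ⊗[k] H) :
    bimul hA hH a y (bimul hA hH b x t) =
      bimul hA hH (hA.mul (a ⊗ₜ b)) (hH.mul (x ⊗ₜ y)) t := by
  hopf_tensor_induction t with c z
  simp [hA.mul_assoc, hH.mul_assoc]

theorem bimul_one_one (hA : HopfStr k A) (hH : HopfStr k H) (t : A ⊗[k] H) :
    bimul hA hH hA.one hH.one t = t := by
  hopf_tensor_induction t with c z
  simp [hA.one_mul, hH.mul_one]

theorem sandwich_eq_bimul (hA : HopfStr k A) (hH : HopfStr k H) (a : A) (y : H)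
    (t : A ⊗[k] H) : sandwich k hA.mul hH.mul ((a ⊗ₜ t) ⊗ₜ y) = bimul hA hH a y t := by
  hopf_tensor_induction t with c z
  simp [sandwich]

/-- The multiplication `(a ⊗ x)(b ⊗ y) = a·τ(x ⊗ b)·y` on `A ⊗ H`, as a coalgebra morphism. -/
noncomputable def twistedMulHom (hA : HopfStr k A) (hH : HopfStr k H)
    (τ : H ⊗[k] A →ₗc[k] A ⊗[k] H) :
    (A ⊗[k] H) ⊗[k] (A ⊗[k] H) →ₗc[k] A ⊗[k] H :=
  (Coalgebra.TensorProduct.map hA.mulHom hH.mulHom).comp <|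
    (Coalgebra.TensorProduct.assoc k k A A (H ⊗[k] H)).symm.toCoalgHom.comp <|
    (CoalgHom.lTensor A <|
      (Coalgebra.TensorProduct.assoc k k A H H).toCoalgHom.comp <|
      (CoalgHom.rTensor H τ).comp
        (Coalgebra.TensorProduct.assoc k k H A H).symm.toCoalgHom).comp <|
    (Coalgebra.TensorProduct.assoc k k A H (A ⊗[k] H)).toCoalgHom

/-- The multiplication `(a ⊗ x)(b ⊗ y) = a·τ(x ⊗ b)·y` on `A ⊗ H`. -/
noncomputable def twistedMul (hA : HopfStr k A) (hH : HopfStr k H)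
    (τ : H ⊗[k] A →ₗc[k] A ⊗[k] H) :
    (A ⊗[k] H) ⊗[k] (A ⊗[k] H) →ₗ[k] A ⊗[k] H :=
  (twistedMulHom hA hH τ).toLinearMap

theorem twistedMul_tmul (hA : HopfStr k A) (hH : HopfStr k H)
    (τ : H ⊗[k] A →ₗc[k] A ⊗[k] H) (a b : A) (x y : H) :
    twistedMul hA hH τ ((a ⊗ₜ x) ⊗ₜ (b ⊗ₜ y)) = bimul hA hH a y (τ (x ⊗ₜ b)) := by
  change TensorProduct.map hA.mul hH.mul ((TensorProduct.assoc k A A (H ⊗[k] H)).symm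
    (a ⊗ₜ TensorProduct.assoc k A H H (τ (x ⊗ₜ b) ⊗ₜ y))) = _
  hopf_tensor_induction τ (x ⊗ₜ b) with c z
  simp

/-- `τ` is a distributive law of `hH` over `hA`. -/
structure IsDistributiveLaw (hA : HopfStr k A) (hH : HopfStr k H)
    (τ : H ⊗[k] A →ₗc[k] A ⊗[k] H) : Prop where
  one_left : ∀ b : A, τ (hH.one ⊗ₜ b) = b ⊗ₜ hH.one
  one_right : ∀ x : H, τ (x ⊗ₜ hA.one) = hA.one ⊗ₜ x
  mul_left : ∀ (x y : H) (b : A), τ (hH.mul (x ⊗ₜ y) ⊗ₜ b) =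
    twistedMul hA hH τ ((hA.one ⊗ₜ x) ⊗ₜ τ (y ⊗ₜ b))
  mul_right : ∀ (x : H) (a b : A), τ (x ⊗ₜ hA.mul (a ⊗ₜ b)) =
    twistedMul hA hH τ (τ (x ⊗ₜ a) ⊗ₜ (b ⊗ₜ hH.one))

namespace IsDistributiveLaw

variable {hA : HopfStr k A} {hH : HopfStr k H} {τ : H ⊗[k] A →ₗc[k] A ⊗[k] H}

theorem bimul_mul_tmul (h : IsDistributiveLaw hA hH τ) (a c : A) (y z : H) (t : A ⊗[k] H) :
    twistedMul hA hH τ (bimul hA hH a y t ⊗ₜ (c ⊗ₜ z)) =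
      bimul hA hH a z (twistedMul hA hH τ (t ⊗ₜ τ (y ⊗ₜ c))) := by
  hopf_tensor_induction t with u v
  rw [bimul_tmul, twistedMul_tmul, h.mul_left]
  hopf_tensor_induction τ (y ⊗ₜ c) with p q
  simp only [twistedMul_tmul, bimul_bimul, hA.mul_one]

theorem tmul_mul_bimul (h : IsDistributiveLaw hA hH τ) (a b : A) (x z : H) (s : A ⊗[k] H) :
    twistedMul hA hH τ ((a ⊗ₜ x) ⊗ₜ bimul hA hH b z s) =
      bimul hA hH a z (twistedMul hA hH τ (τ (x ⊗ₜ b) ⊗ₜ s)) := by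
  hopf_tensor_induction s with p q
  rw [bimul_tmul, twistedMul_tmul, h.mul_right]
  hopf_tensor_induction τ (x ⊗ₜ b) with u v
  simp only [twistedMul_tmul, bimul_bimul, hH.one_mul]

theorem mul_assoc (h : IsDistributiveLaw hA hH τ) (X Y Z : A ⊗[k] H) :
    twistedMul hA hH τ (twistedMul hA hH τ (X ⊗ₜ Y) ⊗ₜ Z) =
      twistedMul hA hH τ (X ⊗ₜ twistedMul hA hH τ (Y ⊗ₜ Z)) := by
  hopf_tensor_induction X with a x
  hopf_tensor_induction Y with b y
  hopf_tensor_induction Z with c z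
  rw [twistedMul_tmul, twistedMul_tmul, h.bimul_mul_tmul, h.tmul_mul_bimul]

/-- The antipode `a ⊗ x ↦ τ(S(x) ⊗ S(a))` of a Hopf structure given by a distributive law. -/
noncomputable def antipode (hA : HopfStr k A) (hH : HopfStr k H)
    (τ : H ⊗[k] A →ₗc[k] A ⊗[k] H) : A ⊗[k] H →ₗ[k] A ⊗[k] H :=
  τ.toLinearMap ∘ₗ TensorProduct.map hH.antipode hA.antipode ∘ₗ
    (TensorProduct.comm k A H).toLinearMap

theorem antipode_tmul (a : A) (x : H) :
    antipode hA hH τ (a ⊗ₜ x) = τ (hH.antipode x ⊗ₜ hA.antipode a) := rfl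

theorem twistedMul_one_tmul_tmul_one (x : H) (a : A) :
    twistedMul hA hH τ ((hA.one ⊗ₜ x) ⊗ₜ (a ⊗ₜ hH.one)) = τ (x ⊗ₜ a) := by
  rw [twistedMul_tmul, bimul_one_one]

theorem twistedMul_tmul_one_tmul (h : IsDistributiveLaw hA hH τ) (a b : A) (y : H) :
    twistedMul hA hH τ ((a ⊗ₜ hH.one) ⊗ₜ (b ⊗ₜ y)) = hA.mul (a ⊗ₜ b) ⊗ₜ y := by
  rw [twistedMul_tmul, h.one_left, bimul_tmul, hH.one_mul]

theorem twistedMul_tmul_tmul_one (h : IsDistributiveLaw hA hH τ) (a : A) (x y : H) :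
    twistedMul hA hH τ ((a ⊗ₜ x) ⊗ₜ (hA.one ⊗ₜ y)) = a ⊗ₜ hH.mul (x ⊗ₜ y) := by
  rw [twistedMul_tmul, h.one_right, bimul_tmul, hA.mul_one]

theorem antipode_left_aux (h : IsDistributiveLaw hA hH τ) (α : A ⊗[k] A) (x y : H) :
    twistedMul hA hH τ (rTensor (A ⊗[k] H) (antipode hA hH τ)
      (TensorProduct.tensorTensorTensorComm k A A H H (α ⊗ₜ (x ⊗ₜ y)))) =
    twistedMul hA hH τ ((hA.one ⊗ₜ hH.antipode x) ⊗ₜ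
      (hA.mul (rTensor A hA.antipode α) ⊗ₜ y)) := by
  hopf_tensor_induction α with a b
  simp only [tensorTensorTensorComm_tmul, rTensor_tmul, antipode_tmul]
  rw [← twistedMul_one_tmul_tmul_one, h.mul_assoc, h.twistedMul_tmul_one_tmul]

theorem antipode_right_aux (h : IsDistributiveLaw hA hH τ) (a b : A) (ξ : H ⊗[k] H) :
    twistedMul hA hH τ (lTensor (A ⊗[k] H) (antipode hA hH τ)
      (TensorProduct.tensorTensorTensorComm k A A H H ((a ⊗ₜ b) ⊗ₜ ξ))) =
    twistedMul hA hH τ ((a ⊗ₜ hH.mul (lTensor H hH.antipode ξ)) ⊗ₜ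
      (hA.antipode b ⊗ₜ hH.one)) := by
  hopf_tensor_induction ξ with x y
  simp only [tensorTensorTensorComm_tmul, lTensor_tmul, antipode_tmul]
  rw [← twistedMul_one_tmul_tmul_one, ← h.mul_assoc, h.twistedMul_tmul_tmul_one]

theorem twistedMul_rTensor_antipode_comul (h : IsDistributiveLaw hA hH τ) (a : A)
    (ξ : H ⊗[k] H) :
    twistedMul hA hH τ (rTensor (A ⊗[k] H) (antipode hA hH τ)
      (TensorProduct.tensorTensorTensorComm k A A H H (Coalgebra.comul a ⊗ₜ ξ))) =
    Coalgebra.counit (R := k) a • (hA.one ⊗ₜ hH.mul (rTensor H hH.antipode ξ)) := by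
  induction ξ with
  | zero => simp only [tmul_zero, map_zero, smul_zero]
  | add _ _ h₁ h₂ => simp only [tmul_add, map_add, smul_add, h₁, h₂]
  | tmul x y =>
    rw [h.antipode_left_aux, hA.mul_rTensor_antipode_comul, ← smul_tmul', tmul_smul, map_smul,
      h.twistedMul_tmul_tmul_one, rTensor_tmul]

theorem twistedMul_lTensor_antipode_comul (h : IsDistributiveLaw hA hH τ) (α : A ⊗[k] A)
    (x : H) :
    twistedMul hA hH τ (lTensor (A ⊗[k] H) (antipode hA hH τ)
      (TensorProduct.tensorTensorTensorComm k A A H H (α ⊗ₜ Coalgebra.comul x))) =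
    Coalgebra.counit (R := k) x • (hA.mul (lTensor A hA.antipode α) ⊗ₜ hH.one) := by
  induction α with
  | zero => simp only [zero_tmul, map_zero, smul_zero]
  | add _ _ h₁ h₂ => simp only [add_tmul, map_add, smul_add, h₁, h₂]
  | tmul a b =>
    rw [h.antipode_right_aux, hH.mul_lTensor_antipode_comul, tmul_smul, ← smul_tmul', map_smul,
      h.twistedMul_tmul_one_tmul, lTensor_tmul]

end IsDistributiveLaw

open IsDistributiveLaw in
/-- The Hopf structure on `A ⊗ H` given by a distributive law. -/
noncomputable def IsDistributiveLaw.hopfStr {hA : HopfStr k A} {hH : HopfStr k H}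
    {τ : H ⊗[k] A →ₗc[k] A ⊗[k] H} (h : IsDistributiveLaw hA hH τ) :
    HopfStr k (A ⊗[k] H) where
  mul := twistedMul hA hH τ
  one := hA.one ⊗ₜ hH.one
  mul_assoc := h.mul_assoc
  one_mul X := by
    hopf_tensor_induction X with a x
    exact (h.twistedMul_tmul_one_tmul _ _ _).trans (by rw [hA.one_mul])
  mul_one X := by
    hopf_tensor_induction X with a x
    exact (h.twistedMul_tmul_tmul_one _ _ _).trans (by rw [hH.mul_one])
  comul_mul X Y := (CoalgHomClass.map_comp_comul_apply (twistedMulHom hA hH τ) (X ⊗ₜ Y)).symm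
  counit_mul X Y :=
    (CoalgHomClass.counit_comp_apply (twistedMulHom hA hH τ) (X ⊗ₜ Y)).trans (mul_comm _ _)
  comul_one := by simp [hA.comul_one, hH.comul_one]
  counit_one := by simp [hA.counit_one, hH.counit_one]
  antipode := antipode hA hH τ
  antipode_left := by
    ext a x
    change twistedMul hA hH τ (rTensor _ (antipode hA hH τ)
      (TensorProduct.tensorTensorTensorComm k A A H H
        (Coalgebra.comul a ⊗ₜ Coalgebra.comul x))) =
      (Coalgebra.counit (R := k) x • Coalgebra.counit (R := k) a) • (hA.one ⊗ₜ[k] hH.one)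
    rw [h.twistedMul_rTensor_antipode_comul, hH.mul_rTensor_antipode_comul, tmul_smul, smul_smul,
      smul_eq_mul, mul_comm]
  antipode_right := by
    ext a x
    change twistedMul hA hH τ (lTensor _ (antipode hA hH τ)
      (TensorProduct.tensorTensorTensorComm k A A H H
        (Coalgebra.comul a ⊗ₜ Coalgebra.comul x))) =
      (Coalgebra.counit (R := k) x • Coalgebra.counit (R := k) a) • (hA.one ⊗ₜ[k] hH.one)
    rw [h.twistedMul_lTensor_antipode_comul, hA.mul_lTensor_antipode_comul, ← smul_tmul',
      smul_smul, smul_eq_mul]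

end DistributiveLaw

section SmashProduct

variable {k}
variable {A H : Type u}
  [AddCommGroup A] [Module k A] [Coalgebra k A]
  [AddCommGroup H] [Module k H] [Coalgebra k H]

/-- The flip of a tensor product of coalgebras, as a coalgebra morphism. -/
noncomputable def commHom (M N : Type u) [AddCommGroup M] [Module k M] [Coalgebra k M]
    [AddCommGroup N] [Module k N] [Coalgebra k N] : M ⊗[k] N →ₗc[k] N ⊗[k] M where
  __ := (TensorProduct.comm k M N).toLinearMap
  counit_comp := by ext; simp [mul_comm]
  map_comp_comul := by
    ext a b
    simp only [TensorProduct.AlgebraTensorModule.curry_apply, TensorProduct.curry_apply,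
      LinearMap.coe_restrictScalars, LinearMap.comp_apply, LinearEquiv.coe_coe, comm_tmul,
      TensorProduct.comul_tmul]
    hopf_tensor_induction Coalgebra.comul (R := k) a with a₁ a₂
    hopf_tensor_induction Coalgebra.comul (R := k) b with b₁ b₂
    simp

theorem isDistributiveLaw_commHom (hA : HopfStr k A) (hH : HopfStr k H) :
    IsDistributiveLaw hA hH (commHom H A) where
  one_left _ := rfl
  one_right _ := rfl
  mul_left x y b := by
    change b ⊗ₜ _ = twistedMul hA hH _ ((_ ⊗ₜ _) ⊗ₜ (b ⊗ₜ y))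
    rw [twistedMul_tmul]
    change _ = bimul hA hH _ _ (b ⊗ₜ x)
    rw [bimul_tmul, hA.one_mul]
  mul_right x a b := by
    change _ ⊗ₜ x = twistedMul hA hH _ ((a ⊗ₜ x) ⊗ₜ _)
    rw [twistedMul_tmul]
    change _ = bimul hA hH _ _ (b ⊗ₜ x)
    rw [bimul_tmul, hH.mul_one]

/-- The action of a fixed vector: `x ↦ x ▶ b`. -/
noncomputable def actOn (act : H ⊗[k] A →ₗ[k] A) (b : A) : H →ₗ[k] A :=
  act ∘ₗ (TensorProduct.mk k H A).flip b

@[simp]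
theorem actOn_apply (act : H ⊗[k] A →ₗ[k] A) (b : A) (x : H) :
    actOn act b x = act (x ⊗ₜ b) := rfl

/-- A module coalgebra action as a coalgebra morphism. -/
noncomputable def IsCoalgebraLaw.hom {act : H ⊗[k] A →ₗ[k] A} (h : IsCoalgebraLaw act) :
    H ⊗[k] A →ₗc[k] A where
  __ := act
  counit_comp := by ext; simp [h.counit_act, mul_comm]
  map_comp_comul := by
    ext x a
    simp [h.comul_act, split, TensorProduct.AlgebraTensorModule.tensorTensorTensorComm_eq]

/-- The map `x ⊗ b ↦ (x₍₂₎ ▶ b) ⊗ x₍₁₎` for a cocommutative `H`, as a coalgebra morphism. -/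
noncomputable def smashHom (hcocomm : IsCocomm k H) {act : H ⊗[k] A →ₗ[k] A}
    (h : IsCoalgebraLaw act) : H ⊗[k] A →ₗc[k] A ⊗[k] H :=
  haveI : Coalgebra.IsCocomm k H := ⟨hcocomm⟩
  (commHom H A).comp <| (CoalgHom.lTensor H h.hom).comp <|
    (Coalgebra.TensorProduct.assoc k k H H A).toCoalgHom.comp <|
    CoalgHom.rTensor A (Coalgebra.comulCoalgHom k H)

theorem smashHom_tmul (hcocomm : IsCocomm k H) {act : H ⊗[k] A →ₗ[k] A}
    (h : IsCoalgebraLaw act) (x : H) (b : A) :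
    smashHom hcocomm h (x ⊗ₜ b) =
      TensorProduct.comm k H A (lTensor H (actOn act b) (Coalgebra.comul x)) := by
  change TensorProduct.comm k H A (lTensor H act (TensorProduct.assoc k H H A
    (Coalgebra.comul x ⊗ₜ b))) = _
  hopf_tensor_induction Coalgebra.comul (R := k) x with p q
  simp

theorem smashHom_tmul_eq_smashEl (hcocomm : IsCocomm k H) {act : H ⊗[k] A →ₗ[k] A}
    (h : IsCoalgebraLaw act) (x : H) (b : A) :
    smashHom hcocomm h (x ⊗ₜ b) = smashEl act x b := by
  rw [smashHom_tmul]
  conv_rhs => rw [smashEl, ← LinearMap.congr_fun hcocomm x]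
  simp only [LinearMap.comp_apply, LinearEquiv.coe_coe]
  hopf_tensor_induction Coalgebra.comul (R := k) x with p q
  simp [rightComm]

/-- The map `p ⊗ q ⊗ r ↦ (q ▶ a)(r ▶ b) ⊗ p`. -/
noncomputable def smashMul (hA : HopfStr k A) (act : H ⊗[k] A →ₗ[k] A) (a b : A) :
    H ⊗[k] (H ⊗[k] H) →ₗ[k] A ⊗[k] H :=
  (TensorProduct.comm k H A).toLinearMap ∘ₗ
    lTensor H (hA.mul ∘ₗ TensorProduct.map (actOn act a) (actOn act b))

@[simp]
theorem smashMul_tmul (hA : HopfStr k A) (act : H ⊗[k] A →ₗ[k] A) (a b : A) (p q r : H) :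
    smashMul hA act a b (p ⊗ₜ (q ⊗ₜ r)) = hA.mul (act (q ⊗ₜ a) ⊗ₜ act (r ⊗ₜ b)) ⊗ₜ p := rfl

theorem smashHom_tmul_mul (hcocomm : IsCocomm k H) {hA : HopfStr k A} {act : H ⊗[k] A →ₗ[k] A}
    (h : IsCoalgebraLaw act) (hm : IsModuleAlgebraLaw hA act) (x : H) (a b : A) :
    smashHom hcocomm h (x ⊗ₜ hA.mul (a ⊗ₜ b)) =
      smashMul hA act a b (lTensor H Coalgebra.comul (Coalgebra.comul x)) := by
  rw [smashHom_tmul]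
  hopf_tensor_induction Coalgebra.comul (R := k) x with p q
  simp only [lTensor_tmul, actOn_apply, comm_tmul, hm.act_mul]
  hopf_tensor_induction Coalgebra.comul (R := k) q with r s
  simp

theorem isDistributiveLaw_smashHom (hcocomm : IsCocomm k H) {hA : HopfStr k A}
    {hH : HopfStr k H} {act : H ⊗[k] A →ₗ[k] A} (h : IsLeftModuleBialgebra hH hA act) :
    IsDistributiveLaw hA hH (smashHom hcocomm h.toCoalgLaw) where
  one_left b := by
    rw [smashHom_tmul, hH.comul_one, lTensor_tmul, comm_tmul, actOn_apply,
      h.toIsLeftModule.one_act]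
  one_right x := by
    rw [smashHom_tmul, show actOn act hA.one = toSpanSingleton k A hA.one ∘ₗ Coalgebra.counit from
      LinearMap.ext h.toLaw.act_one, lTensor_comp_apply, Coalgebra.lTensor_counit_comul]
    simp
  mul_left x y b := by
    rw [smashHom_tmul, smashHom_tmul, hH.comul_mul]
    hopf_tensor_induction Coalgebra.comul (R := k) y with r s
    simp only [lTensor_tmul, comm_tmul, twistedMul_tmul, actOn_apply, smashHom_tmul]
    hopf_tensor_induction Coalgebra.comul (R := k) x with p q
    simp [h.toIsLeftModule.mul_act, hA.one_mul]
  mul_right x a b := by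
    have hc (t : H ⊗[k] H) : lTensor H Coalgebra.comul t =
        lTensor H (TensorProduct.comm k H H).toLinearMap (lTensor H Coalgebra.comul t) := by
      rw [← lTensor_comp_apply, show _ = Coalgebra.comul from hcocomm]
    rw [smashHom_tmul_mul hcocomm _ h.toLaw, hc, ← Coalgebra.coassoc_apply, smashHom_tmul]
    hopf_tensor_induction Coalgebra.comul (R := k) x with p q
    simp only [lTensor_tmul, rTensor_tmul, comm_tmul, twistedMul_tmul, actOn_apply, smashHom_tmul]
    hopf_tensor_induction Coalgebra.comul (R := k) p with r s
    simp [hH.mul_one]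

end SmashProduct

section Brace

variable {k}

/-- The map `x ⊗ z ↦ S(x₍₁₎)·(x₍₂₎ ∘ z)`. -/
noncomputable def lam {V : Type u} [AddCommGroup V] [Module k V] [Coalgebra k V]
    (m : V ⊗[k] V →ₗ[k] V) (S : V →ₗ[k] V) (m' : V ⊗[k] V →ₗ[k] V) : V ⊗[k] V →ₗ[k] V :=
  m ∘ₗ TensorProduct.map S m' ∘ₗ (TensorProduct.assoc k V V V).toLinearMap ∘ₗ
    rTensor V Coalgebra.comul

theorem lam_tmul {V : Type u} [AddCommGroup V] [Module k V] [Coalgebra k V]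
    (m : V ⊗[k] V →ₗ[k] V) (S : V →ₗ[k] V) (m' : V ⊗[k] V →ₗ[k] V) (x z : V) :
    lam m S m' (x ⊗ₜ z) =
      m (TensorProduct.map S m' (TensorProduct.assoc k V V V (Coalgebra.comul x ⊗ₜ z))) := rfl

theorem braceRHS_tmul {V : Type u} [AddCommGroup V] [Module k V] [Coalgebra k V]
    (m : V ⊗[k] V →ₗ[k] V) (S : V →ₗ[k] V) (m' : V ⊗[k] V →ₗ[k] V) (x y z : V) :
    braceRHS m S m' (x ⊗ₜ (y ⊗ₜ z)) =
      m (TensorProduct.map m' (lam m S m')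
        (TensorProduct.tensorTensorTensorComm k V V V V (Coalgebra.comul x ⊗ₜ (y ⊗ₜ z)))) := by
  simp only [braceRHS, LinearMap.comp_apply, rTensor_tmul, LinearEquiv.coe_coe]
  hopf_tensor_induction Coalgebra.comul (R := k) x with p q
  simp only [lTensor_tmul, tensorTensorTensorComm_tmul, TensorProduct.map_tmul, lam_tmul]
  hopf_tensor_induction Coalgebra.comul (R := k) q with r s
  simp

variable {A H : Type u}
  [AddCommGroup A] [Module k A] [Coalgebra k A]
  [AddCommGroup H] [Module k H] [Coalgebra k H]

/-- The map `p ⊗ q ⊗ r ↦ f(r) ⊗ S(p)(qy)`. -/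
noncomputable def antipodeMul (hH : HopfStr k H) (f : H →ₗ[k] A) (y : H) :
    H ⊗[k] (H ⊗[k] H) →ₗ[k] A ⊗[k] H :=
  (TensorProduct.comm k H A).toLinearMap ∘ₗ
    TensorProduct.map (hH.mul ∘ₗ
      TensorProduct.map hH.antipode (hH.mul ∘ₗ (TensorProduct.mk k H H).flip y)) f ∘ₗ
    (TensorProduct.assoc k H H H).symm.toLinearMap

@[simp]
theorem antipodeMul_tmul (hH : HopfStr k H) (f : H →ₗ[k] A) (y p q r : H) :
    antipodeMul hH f y (p ⊗ₜ (q ⊗ₜ r)) =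
      f r ⊗ₜ hH.mul (hH.antipode p ⊗ₜ hH.mul (q ⊗ₜ y)) := rfl

theorem antipodeMul_comul (hH : HopfStr k H) (f : H →ₗ[k] A) (x y : H) :
    antipodeMul hH f y (lTensor H Coalgebra.comul (Coalgebra.comul x)) = f x ⊗ₜ y := by
  have key (t : H ⊗[k] H) : antipodeMul hH f y (TensorProduct.assoc k H H H
      (rTensor H Coalgebra.comul t)) =
      TensorProduct.comm k H A (TensorProduct.map (hH.mul ∘ₗ (TensorProduct.mk k H H).flip y) f
        (rTensor H (hH.mul ∘ₗ rTensor H hH.antipode ∘ₗ Coalgebra.comul) t)) := by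
    hopf_tensor_induction t with p q
    simp only [rTensor_tmul, LinearMap.comp_apply]
    hopf_tensor_induction Coalgebra.comul (R := k) p with r s
    simp [hH.mul_assoc]
  rw [← Coalgebra.coassoc_apply, key, hH.antipode_left, rTensor_comp_apply,
    Coalgebra.rTensor_counit_comul]
  simp [hH.one_mul]

theorem lam_smash (hcocomm : IsCocomm k H) {hA hA' : HopfStr k A}
    {hH : HopfStr k H} {act : H ⊗[k] A →ₗ[k] A} (h : IsCoalgebraLaw act) (a b : A) (x y : H) :
    lam (twistedMul hA hH (commHom H A)) (IsDistributiveLaw.antipode hA hH (commHom H A))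
        (twistedMul hA' hH (smashHom hcocomm h)) ((a ⊗ₜ x) ⊗ₜ (b ⊗ₜ y)) =
      lam hA.mul hA.antipode hA'.mul (a ⊗ₜ act (x ⊗ₜ b)) ⊗ₜ y := by
  have dot_mul (a b : A) (x y : H) : twistedMul hA hH (commHom H A) ((a ⊗ₜ x) ⊗ₜ (b ⊗ₜ y)) =
      hA.mul (a ⊗ₜ b) ⊗ₜ hH.mul (x ⊗ₜ y) := twistedMul_tmul ..
  have antipode_tmul (a : A) (x : H) : IsDistributiveLaw.antipode hA hH (commHom H A) (a ⊗ₜ x) =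
      hA.antipode a ⊗ₜ hH.antipode x := rfl
  simp only [lam_tmul, TensorProduct.comul_tmul,
    TensorProduct.AlgebraTensorModule.tensorTensorTensorComm_eq]
  hopf_tensor_induction Coalgebra.comul (R := k) a with a₁ a₂
  trans antipodeMul hH (hA.mul ∘ₗ TensorProduct.mk k A A (hA.antipode a₁) ∘ₗ hA'.mul ∘ₗ
    TensorProduct.mk k A A a₂ ∘ₗ actOn act b) y (lTensor H Coalgebra.comul (Coalgebra.comul x))
  · hopf_tensor_induction Coalgebra.comul (R := k) x with p q
    simp only [tensorTensorTensorComm_tmul, TensorProduct.assoc_tmul, TensorProduct.map_tmul,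
      antipode_tmul, twistedMul_tmul, smashHom_tmul, lTensor_tmul]
    hopf_tensor_induction Coalgebra.comul (R := k) q with r s
    simp [dot_mul]
  · simp [antipodeMul_comul]

theorem brace_smash (hcocomm : IsCocomm k H) (BA : HopfBrace k A)
    {hH : HopfStr k H} {act : H ⊗[k] A →ₗ[k] A} (h : IsCoalgebraLaw act)
    (hm : IsModuleAlgebraLaw BA.dot act) :
    twistedMul BA.circ hH (smashHom hcocomm h) ∘ₗ
        lTensor (A ⊗[k] H) (twistedMul BA.dot hH (commHom H A)) =
      braceRHS (twistedMul BA.dot hH (commHom H A))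
        (IsDistributiveLaw.antipode BA.dot hH (commHom H A))
        (twistedMul BA.circ hH (smashHom hcocomm h)) := by
  have dot_mul (a b : A) (x y : H) : twistedMul BA.dot hH (commHom H A) ((a ⊗ₜ x) ⊗ₜ (b ⊗ₜ y)) =
      BA.dot.mul (a ⊗ₜ b) ⊗ₜ hH.mul (x ⊗ₜ y) := twistedMul_tmul ..
  have brace (a b c : A) : BA.circ.mul (a ⊗ₜ BA.dot.mul (b ⊗ₜ c)) = _ :=
    (LinearMap.congr_fun BA.brace (a ⊗ₜ (b ⊗ₜ c))).trans (braceRHS_tmul ..)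
  have key (α : A ⊗[k] A) (p q y z : H) (b c : A) :
      twistedMul BA.dot hH (commHom H A) (TensorProduct.map
        (twistedMul BA.circ hH (smashHom hcocomm h))
        (lam (twistedMul BA.dot hH (commHom H A))
          (IsDistributiveLaw.antipode BA.dot hH (commHom H A))
          (twistedMul BA.circ hH (smashHom hcocomm h)))
        (TensorProduct.tensorTensorTensorComm k (A ⊗[k] H) (A ⊗[k] H) (A ⊗[k] H) (A ⊗[k] H)
          (TensorProduct.tensorTensorTensorComm k A A H H (α ⊗ₜ (p ⊗ₜ q)) ⊗ₜ
            ((b ⊗ₜ y) ⊗ₜ (c ⊗ₜ z))))) =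
      TensorProduct.comm k H A (TensorProduct.map
        (hH.mul ∘ₗ (TensorProduct.mk k H H).flip (hH.mul (y ⊗ₜ z)))
        (BA.dot.mul ∘ₗ
          TensorProduct.map BA.circ.mul (lam BA.dot.mul BA.dot.antipode BA.circ.mul) ∘ₗ
          (TensorProduct.tensorTensorTensorComm k A A A A).toLinearMap ∘ₗ
          TensorProduct.mk k (A ⊗[k] A) (A ⊗[k] A) α ∘ₗ
          (TensorProduct.mk k A A).flip (act (q ⊗ₜ c)) ∘ₗ actOn act b)
        (Coalgebra.comul p)) := by
    induction α with
    | zero => simp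
    | add _ _ h₁ h₂ =>
      simp only [add_tmul, map_add, LinearMap.add_comp, LinearMap.comp_add,
        TensorProduct.map_add_right, LinearMap.add_apply, h₁, h₂]
    | tmul a₁ a₂ =>
      simp only [tensorTensorTensorComm_tmul, TensorProduct.map_tmul, lam_smash, twistedMul_tmul,
        smashHom_tmul]
      hopf_tensor_induction Coalgebra.comul (R := k) p with r s
      simp [dot_mul, hH.mul_assoc]
  ext a x b y c z
  simp only [TensorProduct.AlgebraTensorModule.curry_apply, TensorProduct.curry_apply,
    LinearMap.coe_restrictScalars, LinearMap.comp_apply, lTensor_tmul, braceRHS_tmul, dot_mul,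
    twistedMul_tmul, smashHom_tmul_mul hcocomm h hm]
  rw [← Coalgebra.coassoc_apply]
  simp only [TensorProduct.comul_tmul,
    TensorProduct.AlgebraTensorModule.tensorTensorTensorComm_eq]
  hopf_tensor_induction Coalgebra.comul (R := k) x with p q
  rw [key, rTensor_tmul]
  hopf_tensor_induction Coalgebra.comul (R := k) p with r s
  simp [brace]

end Brace


/-- Corollary `11.00`. Let `(A, ·, ∘)` be a Hopf brace and `H` a commutative,
cocommutative Hopf algebra. If `(A, ▶)` is a left `H`-module algebra (w.r.t. `·`) and `(A∘, ▶)`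
is a left `H`-module bialgebra, then the tensor product coalgebra `A ⊗ H` with
`(a ⊗ x)(b ⊗ y) = a·b ⊗ xy` and `(a ⊗ x) ∘ (b ⊗ y) = (a ∘ (x₍₁₎ ▶ b)) ⊗ x₍₂₎y` is a Hopf brace. -/
theorem statement1 {k : Type u} [Field k]
    {A H : Type u} [AddCommGroup A] [Module k A] [Coalgebra k A]
    [AddCommGroup H] [Module k H] [Coalgebra k H]
    (BA : HopfBrace k A) (hH : HopfStr k H)
    (hHcomm : hH.IsComm) (hHcocomm : IsCocomm k H)
    (act : H ⊗[k] A →ₗ[k] A)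
    (hma : IsLeftModuleAlgebra hH BA.dot act)
    (hmb : IsLeftModuleBialgebra hH BA.circ act) :
    ∃ B : HopfBrace k (A ⊗[k] H),
      (∀ (a b : A) (x y : H),
        B.dot.mul ((a ⊗ₜ[k] x) ⊗ₜ[k] (b ⊗ₜ[k] y)) =
          BA.dot.mul (a ⊗ₜ[k] b) ⊗ₜ[k] hH.mul (x ⊗ₜ[k] y)) ∧
      (∀ (a b : A) (x y : H),
        B.circ.mul ((a ⊗ₜ[k] x) ⊗ₜ[k] (b ⊗ₜ[k] y)) =
          sandwich k BA.circ.mul hH.mul ((a ⊗ₜ[k] smashEl act x b) ⊗ₜ[k] y)) := by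
  refine ⟨⟨(isDistributiveLaw_commHom BA.dot hH).hopfStr,
    (isDistributiveLaw_smashHom hHcocomm hmb).hopfStr,
    brace_smash hHcocomm BA hmb.toCoalgLaw hma.toLaw⟩, fun a b x y => twistedMul_tmul ..,
    fun a b x y => ?_⟩
  rw [sandwich_eq_bimul, ← smashHom_tmul_eq_smashEl hHcocomm hmb.toCoalgLaw]
  exact twistedMul_tmul ..

end HopfBraceNL
end
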